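/- arXiv:2305.19363 — 4 statements merged into one kernel-verified Lean document; each statement's English description precedes it below -/
import Mathlib

section
/- Let A be a commutative ring, let Φ: C → D be a full and essentially surjective functor between small categories, and let M be a D-module over A. If M is a finitely generated D-module, then the restriction Φ^*M is a finitely generated C-module. -/
/-!
Categorical modules: for a small category `C` and a commutative ring `A`,
a `C`-module over `A` is a functor `C ⥤ ModuleCat A`.
-/

open CategoryTheory Limits

universe u

/-- The free `C`-module `C(c₀, •)` over `A`: it sends `c` to the free `A`-module
on the hom-set `c₀ ⟶ c`. -/
noncomputable def freeMod (A : Type u) [CommRing A] {C : Type u} [SmallCategory C] (c₀ : C) :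
    C ⥤ ModuleCat.{u} A :=
  coyoneda.obj (Opposite.op c₀) ⋙ ModuleCat.free A

/-- A `C`-module over `A` is finitely generated if it admits a map from a finite
direct sum of free modules that is surjective at every object. -/
noncomputable def IsFinitelyGenerated (A : Type u) [CommRing A] {C : Type u} [SmallCategory C]
    (M : C ⥤ ModuleCat.{u} A) : Prop :=
  ∃ (n : ℕ) (c : Fin n → C) (p : (∐ fun i : Fin n => freeMod A (c i)) ⟶ M),
    ∀ d : C, Function.Surjective (p.app d)

/-- The map `C(c, •) ⟶ Φ^*D(d, •)` induced by a morphism `d ⟶ Φ.obj c`. -/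
noncomputable def freeModToRestriction (A : Type u) [CommRing A] {C D : Type u}
    [SmallCategory C] [SmallCategory D] (Φ : C ⥤ D) {c : C} {d : D} (e : d ⟶ Φ.obj c) :
    freeMod A c ⟶ Φ ⋙ freeMod A d :=
  Functor.whiskerRight
    (show coyoneda.obj (Opposite.op c) ⟶ Φ ⋙ coyoneda.obj (Opposite.op d) from
      { app := fun _ => TypeCat.ofHom fun f => e ≫ Φ.map f })
    (ModuleCat.free A)

instance freeModToRestriction_epi (A : Type u) [CommRing A] {C D : Type u}
    [SmallCategory C] [SmallCategory D] (Φ : C ⥤ D) [Φ.Full] {c : C} {d : D}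
    (e : d ⟶ Φ.obj c) [IsIso e] : Epi (freeModToRestriction A Φ e) := by
  rw [NatTrans.epi_iff_epi_app]
  intro x
  have : Epi (TypeCat.ofHom fun f : c ⟶ x => e ≫ Φ.map f) := by
    rw [epi_iff_surjective]
    intro f
    obtain ⟨g, hg⟩ := Φ.map_surjective (inv e ≫ f)
    exact ⟨g, by simp [hg]⟩
  have : (ModuleCat.free.{u} A).PreservesEpimorphisms :=
    Functor.preservesEpimorphisms_of_adjunction (ModuleCat.adj A)
  exact inferInstanceAs (Epi ((ModuleCat.free A).map
    (TypeCat.ofHom fun f : c ⟶ x => e ≫ Φ.map f)))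

/-- if `Φ : C ⥤ D` is full and essentially surjective and the `D`-module `M`
is finitely generated, then so is its restriction `Φ^*M = Φ ⋙ M`. -/
theorem restriction_finitelyGenerated (A : Type u) [CommRing A] (C D : Type u)
    [SmallCategory C] [SmallCategory D] (Φ : C ⥤ D) [Φ.Full] [Φ.EssSurj]
    (M : D ⥤ ModuleCat.{u} A) (hM : IsFinitelyGenerated A M) :
    IsFinitelyGenerated A (Φ ⋙ M) := by
  obtain ⟨n, d, p, hp⟩ := hM
  let R := (Functor.whiskeringLeft C D (ModuleCat.{u} A)).obj Φ
  let g (i : Fin n) : freeMod A (Φ.objPreimage (d i)) ⟶ R.obj (freeMod A (d i)) :=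
    freeModToRestriction A Φ (Φ.objObjPreimageIso (d i)).inv
  have (i : Fin n) : Epi (g i) := freeModToRestriction_epi A Φ _
  have : Epi p := by
    rw [NatTrans.epi_iff_epi_app]
    exact fun x => (ModuleCat.epi_iff_surjective _).mpr (hp x)
  let q : (∐ fun i => freeMod A (Φ.objPreimage (d i))) ⟶ Φ ⋙ M :=
    Limits.Sigma.map g ≫ sigmaComparison R (fun i => freeMod A (d i)) ≫ R.map p
  have hq : Epi q := inferInstance
  rw [NatTrans.epi_iff_epi_app] at hq
  exact ⟨n, _, q, fun x => (ModuleCat.epi_iff_surjective _).mp (hq x)⟩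
end

section
/- Let G and G' be finite simple graphs. If there exists a topological minor morphism from G to G', then the first Betti number of G is at most the first Betti number of G', where the first Betti number of a finite simple graph is its number of edges minus its number of vertices plus its number of connected components. -/
/-- A path in a simple graph: a walk with distinct vertices, together with its
(ordered) endpoints. Paths in the paper are considered modulo reversal; see `PathQ`. -/
structure OPath {V : Type} (G : SimpleGraph V) where
  first : V
  last : V
  walk : G.Walk first last
  isPath : walk.IsPath

/-- Reversal of a path. -/
def OPath.rev {V : Type} {G : SimpleGraph V} (p : OPath G) : OPath G :=
  ⟨p.last, p.first, p.walk.reverse, p.isPath.reverse⟩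

theorem OPath.rev_rev {V : Type} {G : SimpleGraph V} (p : OPath G) : p.rev.rev = p := by
  cases p
  simp [OPath.rev]

/-- Two paths are identified when one is the reversal of the other. -/
def revSetoid {V : Type} (G : SimpleGraph V) : Setoid (OPath G) where
  r p q := p = q ∨ p = q.rev
  iseqv := by
    constructor
    · intro p; exact Or.inl rfl
    · rintro p q (rfl | rfl)
      · exact Or.inl rfl
      · exact Or.inr q.rev_rev.symm
    · rintro p q r (rfl | rfl) (h | h)
      · exact Or.inl h
      · exact Or.inr h
      · exact Or.inr (by rw [h])
      · rw [h, OPath.rev_rev]; exact Or.inl rfl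

/-- The set `P_G` of paths of `G`: paths modulo reversal of order. -/
def PathQ {V : Type} (G : SimpleGraph V) : Type := Quotient (revSetoid G)

/-- The pair of endpoints of a path. -/
def PathQ.ends {V : Type} {G : SimpleGraph V} : PathQ G → Sym2 V :=
  Quotient.lift (fun p => s(p.first, p.last)) (by
    rintro p q (rfl | rfl)
    · rfl
    · exact Sym2.eq_swap)

/-- The set of vertices lying on a path. -/
def PathQ.suppSet {V : Type} {G : SimpleGraph V} : PathQ G → Set V :=
  Quotient.lift (fun p => {x | x ∈ p.walk.support}) (by
    rintro p q (rfl | rfl)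
    · rfl
    · ext x
      simp [OPath.rev])

/-- The set of edges traversed by a path. -/
def PathQ.edgesSet {V : Type} {G : SimpleGraph V} : PathQ G → Set (Sym2 V) :=
  Quotient.lift (fun p => {x | x ∈ p.walk.edges}) (by
    rintro p q (rfl | rfl)
    · rfl
    · ext x
      simp [OPath.rev])

/-- A topological minor morphism `ρ : G → G'` between simple graphs: an injective map
`ρ_V` on vertices together with a map `ρ_E` from edges to paths (modulo reversal) of `G'`
such that:
(1) `ρ_V` is injective;
(2) `ρ_E e` has endpoints the images of the endpoints of `e`;
(3) `ρ_V v` lies on `ρ_E e` if and only if `e` is incident to `v`;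
(4) if distinct edges share a common endpoint `v`, their image paths intersect exactly in
`{ρ_V v}`, and if they share no endpoint, their image paths are disjoint. -/
structure TMHom {V V' : Type} (G : SimpleGraph V) (G' : SimpleGraph V') where
  toFunV : V → V'
  toFunE : G.edgeSet → PathQ G'
  injV : Function.Injective toFunV
  ends_eq : ∀ e : G.edgeSet, (toFunE e).ends = Sym2.map toFunV (e : Sym2 V)
  mem_iff : ∀ (e : G.edgeSet) (v : V), toFunV v ∈ (toFunE e).suppSet ↔ v ∈ (e : Sym2 V)
  inter_shared : ∀ (e₁ e₂ : G.edgeSet), e₁ ≠ e₂ → ∀ v : V,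
      v ∈ (e₁ : Sym2 V) → v ∈ (e₂ : Sym2 V) →
      (toFunE e₁).suppSet ∩ (toFunE e₂).suppSet = {toFunV v}
  inter_disjoint : ∀ (e₁ e₂ : G.edgeSet), e₁ ≠ e₂ →
      (∀ v : V, ¬(v ∈ (e₁ : Sym2 V) ∧ v ∈ (e₂ : Sym2 V))) →
      (toFunE e₁).suppSet ∩ (toFunE e₂).suppSet = ∅

/-- The first Betti number of a finite simple graph: `|E| - |V| + c`, where `c` is the
number of connected components. -/
noncomputable def bettiNumber {V : Type} (G : SimpleGraph V) : ℤ :=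
  (Nat.card G.edgeSet : ℤ) - (Nat.card V : ℤ) + (Nat.card G.ConnectedComponent : ℤ)

/-- The value on a pair of vertices of the mod 2 coboundary of a function on vertices. -/
def pairSum {V : Type} (g : V → ZMod 2) : Sym2 V → ZMod 2 :=
  Sym2.lift ⟨fun u v => g u + g v, fun u v => add_comm (g u) (g v)⟩

@[simp]
theorem pairSum_mk {V : Type} (g : V → ZMod 2) (u v : V) : pairSum g s(u, v) = g u + g v := rfl

theorem pairSum_map {V V' : Type} (g : V' → ZMod 2) (f : V → V') (e : Sym2 V) :
    pairSum g (e.map f) = pairSum (g ∘ f) e := by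
  induction e with | _ u v => rfl

/-- The mod 2 coboundary map of a simple graph. -/
def coboundary {V : Type} (G : SimpleGraph V) : (V → ZMod 2) →ₗ[ZMod 2] (G.edgeSet → ZMod 2) where
  toFun g e := pairSum g e
  map_add' g h := by
    ext ⟨e, he⟩
    induction e with | _ u v => simp [add_add_add_comm]
  map_smul' c g := by
    ext ⟨e, he⟩
    induction e with | _ u v => simp [mul_add]

@[simp]
theorem coboundary_apply {V : Type} (G : SimpleGraph V) (g : V → ZMod 2) (e : G.edgeSet) :
    coboundary G g e = pairSum g e := rfl

theorem ker_coboundary {V : Type} (G : SimpleGraph V) :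
    (coboundary G).ker =
      (LinearMap.funLeft (ZMod 2) (ZMod 2) G.connectedComponentMk).range := by
  ext g
  simp only [LinearMap.mem_ker, LinearMap.mem_range]
  constructor
  · intro h
    have hadj : ∀ u v, G.Adj u v → g u = g v := fun u v huv => by
      have := congrFun h ⟨s(u, v), huv⟩
      simpa [CharTwo.add_eq_zero] using this
    have hwalk : ∀ u v (p : G.Walk u v), g u = g v := fun u v p => by
      induction p with
      | nil => rfl
      | cons huv _ ih => exact (hadj _ _ huv).trans ih
    exact ⟨SimpleGraph.ConnectedComponent.lift g fun u v p _ => hwalk u v p, rfl⟩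
  · rintro ⟨f, rfl⟩
    ext ⟨e, he⟩
    induction e with
    | _ u v =>
      have : G.connectedComponentMk u = G.connectedComponentMk v :=
        SimpleGraph.ConnectedComponent.sound (SimpleGraph.Adj.reachable he)
      simp [LinearMap.funLeft_apply, this, CharTwo.add_self_eq_zero]

theorem bettiNumber_eq_finrank {V : Type} [Finite V] (G : SimpleGraph V) :
    bettiNumber G =
      Module.finrank (ZMod 2) ((G.edgeSet → ZMod 2) ⧸ (coboundary G).range) := by
  have := Fintype.ofFinite V
  have := Fintype.ofFinite G.edgeSet
  have := Fintype.ofFinite G.ConnectedComponent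
  have hker : Module.finrank (ZMod 2) (coboundary G).ker = Nat.card G.ConnectedComponent := by
    rw [ker_coboundary, LinearMap.finrank_range_of_inj
      (LinearMap.funLeft_injective_of_surjective _ _ G.connectedComponentMk Quot.mk_surjective)]
    simp
  have hrank := (coboundary G).finrank_range_add_finrank_ker
  have hquot := (coboundary G).range.finrank_quotient_add_finrank
  rw [hker, Module.finrank_fintype_fun_eq_card] at hrank
  rw [Module.finrank_fintype_fun_eq_card] at hquot
  rw [bettiNumber, Nat.card_eq_fintype_card (α := V), Nat.card_eq_fintype_card (α := G.edgeSet)]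
  omega

open scoped Classical in
theorem SimpleGraph.Walk.IsTrail.sum_coboundary {V : Type} {G : SimpleGraph V} [Fintype G.edgeSet]
    (g : V → ZMod 2) {u v : V} {p : G.Walk u v} (hp : p.IsTrail) :
    ∑ e : G.edgeSet, (if (e : Sym2 V) ∈ p.edges then coboundary G g e else 0) = g u + g v := by
  induction p with
  | nil => simp [CharTwo.add_self_eq_zero]
  | @cons a b c h q ih =>
    obtain ⟨hq, hnot⟩ := (SimpleGraph.Walk.isTrail_cons h q).1 hp
    have hsplit : ∀ e : G.edgeSet,
        (if (e : Sym2 V) ∈ (SimpleGraph.Walk.cons h q).edges then coboundary G g e else 0) =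
          (if e = ⟨s(a, b), h⟩ then coboundary G g e else 0) +
            (if (e : Sym2 V) ∈ q.edges then coboundary G g e else 0) := by
      rintro ⟨e, he⟩
      by_cases hab : e = s(a, b)
      · subst hab
        simp [hnot]
      · simp [hab, Subtype.ext_iff]
    rw [Finset.sum_congr rfl fun e _ => hsplit e, Finset.sum_add_distrib, ih hq,
      Finset.sum_ite_eq' Finset.univ]
    simp only [Finset.mem_univ, if_true, coboundary_apply, pairSum_mk]
    linear_combination CharTwo.add_self_eq_zero (g b)

open scoped Classical in
theorem PathQ.sum_coboundary {V : Type} {G : SimpleGraph V} [Fintype G.edgeSet]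
    (g : V → ZMod 2) (p : PathQ G) :
    ∑ e : G.edgeSet, (if (e : Sym2 V) ∈ p.edgesSet then coboundary G g e else 0) =
      pairSum g p.ends := by
  induction p using Quotient.inductionOn with
  | _ p =>
    refine Eq.trans (Finset.sum_congr rfl fun e _ => ?_) (p.isPath.isTrail.sum_coboundary g)
    by_cases h : (e : Sym2 V) ∈ p.walk.edges
    · exact (if_pos h).trans (if_pos h).symm
    · exact (if_neg h).trans (if_neg h).symm

theorem PathQ.mem_suppSet_of_mem_edgesSet {V : Type} {G : SimpleGraph V} {p : PathQ G}
    {e : Sym2 V} {v : V} (he : e ∈ p.edgesSet) (hv : v ∈ e) : v ∈ p.suppSet := by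
  induction p using Quotient.inductionOn with
  | _ p => exact p.walk.mem_support_of_mem_edges he hv

theorem PathQ.exists_mem_edgesSet {V : Type} {G : SimpleGraph V} {p : PathQ G}
    (hp : ¬ p.ends.IsDiag) : ∃ e : G.edgeSet, (e : Sym2 V) ∈ p.edgesSet := by
  induction p using Quotient.inductionOn with
  | _ p =>
    obtain ⟨u, v, w, hw⟩ := p
    cases w with
    | nil => exact absurd rfl hp
    | cons h q => exact ⟨⟨_, h⟩, List.mem_cons_self⟩

namespace TMHom

variable {V V' : Type} {G : SimpleGraph V} {G' : SimpleGraph V'}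

theorem suppSet_inter_subsingleton (ρ : TMHom G G') {e₁ e₂ : G.edgeSet} (h : e₁ ≠ e₂) :
    ((ρ.toFunE e₁).suppSet ∩ (ρ.toFunE e₂).suppSet).Subsingleton := by
  by_cases hv : ∃ v : V, v ∈ (e₁ : Sym2 V) ∧ v ∈ (e₂ : Sym2 V)
  · obtain ⟨v, h₁, h₂⟩ := hv
    rw [ρ.inter_shared e₁ e₂ h v h₁ h₂]
    exact Set.subsingleton_singleton
  · rw [ρ.inter_disjoint e₁ e₂ h (not_exists.1 hv)]
    exact Set.subsingleton_empty

theorem eq_of_mem_edgesSet (ρ : TMHom G G') {e₁ e₂ : G.edgeSet} {e : G'.edgeSet}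
    (h₁ : (e : Sym2 V') ∈ (ρ.toFunE e₁).edgesSet) (h₂ : (e : Sym2 V') ∈ (ρ.toFunE e₂).edgesSet) :
    e₁ = e₂ := by
  by_contra h
  obtain ⟨e, he⟩ := e
  induction e with
  | _ u v =>
    refine SimpleGraph.Adj.ne he (ρ.suppSet_inter_subsingleton h ⟨?_, ?_⟩ ⟨?_, ?_⟩)
    · exact PathQ.mem_suppSet_of_mem_edgesSet h₁ (Sym2.mem_mk_left u v)
    · exact PathQ.mem_suppSet_of_mem_edgesSet h₂ (Sym2.mem_mk_left u v)
    · exact PathQ.mem_suppSet_of_mem_edgesSet h₁ (Sym2.mem_mk_right u v)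
    · exact PathQ.mem_suppSet_of_mem_edgesSet h₂ (Sym2.mem_mk_right u v)

theorem exists_mem_edgesSet (ρ : TMHom G G') (e : G.edgeSet) :
    ∃ e' : G'.edgeSet, (e' : Sym2 V') ∈ (ρ.toFunE e).edgesSet := by
  apply PathQ.exists_mem_edgesSet
  rw [ρ.ends_eq, Sym2.isDiag_map ρ.injV]
  exact G.not_isDiag_of_mem_edgeSet e.2

open scoped Classical in
/-- The map on mod 2 1-cochains summing over the edges of the image paths. -/
noncomputable def pullback [Fintype G'.edgeSet] (ρ : TMHom G G') :
    (G'.edgeSet → ZMod 2) →ₗ[ZMod 2] (G.edgeSet → ZMod 2) where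
  toFun f e := ∑ e' : G'.edgeSet, if (e' : Sym2 V') ∈ (ρ.toFunE e).edgesSet then f e' else 0
  map_add' f g := by
    ext e
    simp only [Pi.add_apply, ← Finset.sum_add_distrib]
    exact Finset.sum_congr rfl fun e' _ => by split_ifs <;> simp
  map_smul' c f := by
    ext e
    simp [Finset.mul_sum]

theorem pullback_coboundary [Fintype G'.edgeSet] (ρ : TMHom G G') (g : V' → ZMod 2) :
    ρ.pullback (coboundary G' g) = coboundary G (g ∘ ρ.toFunV) := by
  ext e
  exact (PathQ.sum_coboundary g (ρ.toFunE e)).trans (by rw [ρ.ends_eq, pairSum_map]; rfl)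

theorem pullback_surjective [Fintype G'.edgeSet] (ρ : TMHom G G') :
    Function.Surjective ρ.pullback := by
  classical
  intro h
  choose s hs using ρ.exists_mem_edgesSet
  have hinj : Function.Injective s := fun e₁ e₂ h₁₂ =>
    ρ.eq_of_mem_edgesSet (hs e₁) (h₁₂ ▸ hs e₂)
  refine ⟨Function.extend s h 0, funext fun e => ?_⟩
  refine (Finset.sum_eq_single (s e) (fun e' _ hne => ?_) (by simp)).trans ?_
  · split_ifs with he'
    · refine Function.extend_apply' h (0 : G'.edgeSet → ZMod 2) e' ?_
      rintro ⟨e₁, rfl⟩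
      exact hne (congrArg s (ρ.eq_of_mem_edgesSet (hs e₁) he'))
    · rfl
  · rw [if_pos (hs e), hinj.extend_apply]

end TMHom

/-- if there is a topological minor morphism `G → G'` between finite simple
graphs, then the first Betti number of `G` is at most that of `G'`. -/
theorem bettiNumber_le_of_tmHom {V V' : Type} [Fintype V] [Fintype V']
    (G : SimpleGraph V) (G' : SimpleGraph V') (ρ : TMHom G G') :
    bettiNumber G ≤ bettiNumber G' := by
  have := Fintype.ofFinite G.edgeSet
  have := Fintype.ofFinite G'.edgeSet
  rw [bettiNumber_eq_finrank, bettiNumber_eq_finrank, Nat.cast_le]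
  have hle : (coboundary G').range ≤ (coboundary G).range.comap ρ.pullback := by
    rintro _ ⟨g, rfl⟩
    exact ⟨g ∘ ρ.toFunV, (ρ.pullback_coboundary g).symm⟩
  refine LinearMap.finrank_le_finrank_of_surjective
    (f := Submodule.mapQ _ _ ρ.pullback hle) fun y => ?_
  obtain ⟨h, rfl⟩ := Submodule.Quotient.mk_surjective _ y
  obtain ⟨f, rfl⟩ := ρ.pullback_surjective h
  exact ⟨Submodule.Quotient.mk f, rfl⟩
end

section
/- Let Q be a well-quasi-ordered set and A a Noetherian commutative ring. Then the category whose objects are finite simple forests with vertices labeled by elements of Q, and whose morphisms are topological minor morphisms ρ such that for every vertex v the label of v is ≤ the label of ρ_V(v), is Noetherian over A: every submodule of a finitely generated module over this category is finitely generated. -/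
/-- A finite simple forest (a finite simple graph with no cycles) with vertices labeled by
elements of the quasi-order `Q`. -/
structure LForest (Q : Type) : Type where
  n : ℕ
  graph : SimpleGraph (Fin n)
  acyclic : graph.IsAcyclic
  label : Fin n → Q

/-- A morphism of `Q`-labeled forests: a topological minor morphism `ρ` such that the label
of every vertex `v` is `≤` the label of `ρ_V v`. -/
structure LFHom {Q : Type} [Preorder Q] (T T' : LForest Q) extends
    TMHom T.graph T'.graph : Type where
  label_le : ∀ v : Fin T.n, T.label v ≤ T'.label (toFunV v)

/-- A module over the category of `Q`-labeled forests and label-compatible topological minor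
morphisms, with values in `A`-modules: the data of an `A`-module `M T` for every labeled
forest `T` and an `A`-linear map `act f : M T →ₗ M T'` for every morphism `f : T → T'`,
functorial for identities and composition.  (The identity morphism of `T` is the one acting
identically on vertices and sending each edge to the corresponding one-edge path, and the
composite of `ρ` and `σ` is the morphism `(σ_V ∘ ρ_V, σ_P ∘ ρ_E)`, where `σ_P` concatenates
the paths `σ_E e'` over the consecutive edges `e'` of a path; a path modulo reversal is
uniquely determined by its endpoints and its set of edges, which is how the identity and
the composite are recognized in the functoriality axioms below.) -/
structure LFMod (Q : Type) [Preorder Q] (A : Type) [CommRing A] : Type 1 where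
  M : LForest Q → Type
  [addCommGroup : ∀ T, AddCommGroup (M T)]
  [module : ∀ T, Module A (M T)]
  act : ∀ {T T' : LForest Q}, LFHom T T' → (M T →ₗ[A] M T')
  act_id : ∀ (T : LForest Q) (τ : LFHom T T), τ.toFunV = id →
      (∀ e : T.graph.edgeSet, (τ.toFunE e).edgesSet = {(e : Sym2 (Fin T.n))}) →
      act τ = LinearMap.id
  act_comp : ∀ {T T' T'' : LForest Q} (ρ : LFHom T T') (σ : LFHom T' T'') (τ : LFHom T T''),
      τ.toFunV = σ.toFunV ∘ ρ.toFunV →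
      (∀ e : T.graph.edgeSet, (τ.toFunE e).edgesSet =
        {x : Sym2 (Fin T''.n) | ∃ e' : T'.graph.edgeSet,
          (e' : Sym2 (Fin T'.n)) ∈ (ρ.toFunE e).edgesSet ∧ x ∈ (σ.toFunE e').edgesSet}) →
      act τ = (act σ).comp (act ρ)

attribute [instance] LFMod.addCommGroup LFMod.module

/-- A module over the category of `Q`-labeled forests is finitely generated if it is
generated by finitely many elements `x j ∈ M (T j)`; equivalently (by the Yoneda lemma),
it admits a map from a finite direct sum of free modules that is surjective at every
object. -/
def LFMod.IsFG {Q : Type} [Preorder Q] {A : Type} [CommRing A] (𝓜 : LFMod Q A) : Prop :=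
  ∃ (k : ℕ) (T : Fin k → LForest Q) (x : ∀ j : Fin k, 𝓜.M (T j)),
    ∀ (T' : LForest Q) (y : 𝓜.M T'),
      y ∈ Submodule.span A
        {z : 𝓜.M T' | ∃ (j : Fin k) (f : LFHom (T j) T'), z = 𝓜.act f (x j)}

namespace PlaneTree

/-- The longest common prefix of two lists. -/
def lcp : List ℕ → List ℕ → List ℕ
  | a :: u, b :: v => if a = b then a :: lcp u v else []
  | _, _ => []

@[simp] theorem lcp_nil_left (v : List ℕ) : lcp [] v = [] := by simp [lcp]

@[simp] theorem lcp_nil_right (u : List ℕ) : lcp u [] = [] := by simp [lcp]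

theorem lcp_cons_self (a : ℕ) (u v : List ℕ) : lcp (a :: u) (a :: v) = a :: lcp u v := by
  simp [lcp]

theorem lcp_cons_ne {a b : ℕ} (h : a ≠ b) (u v : List ℕ) : lcp (a :: u) (b :: v) = [] := by
  simp [lcp, h]

theorem prefix_lcp_iff {w u v : List ℕ} : w <+: lcp u v ↔ w <+: u ∧ w <+: v := by
  induction u generalizing w v with
  | nil => simp +contextual
  | cons a u ih =>
    cases v with
    | nil => simp +contextual
    | cons b v =>
      cases w with
      | nil => simp
      | cons c w =>
        by_cases h : a = b
        · subst h
          simp only [lcp_cons_self, List.cons_prefix_cons, ih]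
          tauto
        · simp only [lcp_cons_ne h, List.cons_prefix_cons, List.prefix_nil]
          constructor
          · simp
          · rintro ⟨⟨rfl, -⟩, rfl, -⟩
            exact absurd rfl h

theorem lcp_eq_left_iff {u v : List ℕ} : lcp u v = u ↔ u <+: v := by
  constructor
  · intro h
    have h' : u <+: lcp u v := by simp [h]
    exact (prefix_lcp_iff.1 h').2
  · intro h
    exact List.IsPrefix.eq_of_length_le (prefix_lcp_iff.1 (List.prefix_refl (lcp u v))).1
      (prefix_lcp_iff.2 ⟨List.prefix_refl u, h⟩).length_le

/-- Maps of addresses that preserve the lexicographic order and longest common prefixes. -/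
structure IsPlaneEmb (φ : List ℕ → List ℕ) : Prop where
  strictMono : StrictMono φ
  map_lcp : ∀ u v, lcp (φ u) (φ v) = φ (lcp u v)

namespace IsPlaneEmb

theorem id : IsPlaneEmb id := ⟨strictMono_id, fun _ _ => rfl⟩

theorem comp {φ ψ : List ℕ → List ℕ} (hφ : IsPlaneEmb φ) (hψ : IsPlaneEmb ψ) :
    IsPlaneEmb (φ ∘ ψ) :=
  ⟨hφ.strictMono.comp hψ.strictMono, fun u v => by
    simp [hφ.map_lcp, hψ.map_lcp]⟩

theorem cons (i : ℕ) : IsPlaneEmb (List.cons i) :=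
  ⟨fun u v h => by simpa [List.cons_lt_cons_iff] using h, lcp_cons_self i⟩

theorem node {e : ℕ → ℕ} (he : StrictMono e) {ψ : ℕ → List ℕ → List ℕ}
    (hψ : ∀ k, IsPlaneEmb (ψ k)) :
    IsPlaneEmb (fun l => match l with | [] => [] | k :: l => e k :: ψ k l) := by
  constructor
  · intro u v h
    cases u with
    | nil =>
      cases v with
      | nil => simp at h
      | cons b v => simp
    | cons a u =>
      cases v with
      | nil => simp at h
      | cons b v =>
        rw [List.cons_lt_cons_iff] at h
        simp only [List.cons_lt_cons_iff]
        rcases h with h | ⟨rfl, h⟩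
        · exact Or.inl (he h)
        · exact Or.inr ⟨rfl, (hψ a).strictMono h⟩
  · intro u v
    cases u with
    | nil => simp
    | cons a u =>
      cases v with
      | nil => simp
      | cons b v =>
        by_cases h : a = b
        · subst h
          simp [lcp_cons_self, (hψ a).map_lcp]
        · simp [lcp_cons_ne h, lcp_cons_ne (he.injective.ne h)]

theorem prefix_iff {φ : List ℕ → List ℕ} (hφ : IsPlaneEmb φ) {u v : List ℕ} :
    φ u <+: φ v ↔ u <+: v := by
  rw [← lcp_eq_left_iff, hφ.map_lcp, hφ.strictMono.injective.eq_iff, lcp_eq_left_iff]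

end IsPlaneEmb

/-- `Emb r s t`: the `X`-labeled plane tree `s` embeds in `t`, a plane tree being encoded as the
partial function sending the address of a node to its label. -/
def Emb {X : Type*} (r : X → X → Prop) (s t : List ℕ → Option X) : Prop :=
  ∃ φ, IsPlaneEmb φ ∧ ∀ l a, s l = some a → ∃ b, t (φ l) = some b ∧ r a b

theorem Emb.isPreorder {X : Type*} (r : X → X → Prop) [IsPreorder X r] :
    IsPreorder (List ℕ → Option X) (Emb r) where
  refl s := ⟨id, .id, fun l a h => ⟨a, h, refl a⟩⟩
  trans := by
    rintro s t u ⟨φ, hφ, h⟩ ⟨ψ, hψ, h'⟩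
    refine ⟨ψ ∘ φ, hψ.comp hφ, fun l a ha => ?_⟩
    obtain ⟨b, hb, hab⟩ := h l a ha
    obtain ⟨c, hc, hbc⟩ := h' _ b hb
    exact ⟨c, hc, _root_.trans hab hbc⟩

theorem emb_subtree {X : Type*} (r : X → X → Prop) [IsPreorder X r] (t : List ℕ → Option X)
    (i : ℕ) : Emb r (fun l => t (i :: l)) t :=
  ⟨List.cons i, .cons i, fun _ a h => ⟨a, h, refl a⟩⟩

theorem exists_strictMono_of_sublistForall₂ {α β : Type*} {R : α → β → Prop} {ss : List α}
    {ts : List β} (h : List.SublistForall₂ R ss ts) :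
    ∃ e : ℕ → ℕ, StrictMono e ∧ ∀ (k : ℕ) s, ss[k]? = some s → ∃ t, ts[e k]? = some t ∧ R s t := by
  induction h with
  | nil => exact ⟨_root_.id, strictMono_id, by simp⟩
  | @cons a b ss ts hab _ ih =>
    obtain ⟨e, he, h⟩ := ih
    refine ⟨fun k => k.casesOn 0 (fun k => e k + 1), ?_, ?_⟩
    · refine strictMono_nat_of_lt_succ fun n => ?_
      cases n with
      | zero => simp
      | succ n => simpa using he (Nat.lt_succ_self n)
    · intro k s hk
      cases k with
      | zero =>
        obtain rfl : a = s := by simpa using hk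
        exact ⟨b, by simp, hab⟩
      | succ k => simpa using h k s (by simpa using hk)
  | @cons_right b ss ts _ ih =>
    obtain ⟨e, he, h⟩ := ih
    exact ⟨fun k => e k + 1, fun m n hmn => by simpa using he hmn, fun k s hk => by
      simpa using h k s hk⟩

theorem emb_of_children {X : Type*} {r : X → X → Prop} {s t : List ℕ → Option X}
    (hroot : ∀ a, s [] = some a → ∃ b, t [] = some b ∧ r a b) {m n : ℕ}
    (hs : ∀ i l, m ≤ i → s (i :: l) = none)
    (h : List.SublistForall₂ (Emb r) ((List.range m).map fun i l => s (i :: l))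
      ((List.range n).map fun i l => t (i :: l))) : Emb r s t := by
  obtain ⟨e, he, h⟩ := exists_strictMono_of_sublistForall₂ h
  have key : ∀ k, ∃ φ, IsPlaneEmb φ ∧
      ∀ l a, s (k :: l) = some a → ∃ b, t (e k :: φ l) = some b ∧ r a b := by
    intro k
    by_cases hk : k < m
    · obtain ⟨t', ht', φ, hφ, h'⟩ := h k (fun l => s (k :: l)) (by simp [hk])
      obtain ⟨-, rfl⟩ : e k < n ∧ (fun l => t (e k :: l)) = t' := by
        by_cases hn : e k < n
        · exact ⟨hn, by simpa [hn] using ht'⟩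
        · simp [List.getElem?_eq_none (show (List.range n).length ≤ e k by simpa using hn)] at ht'
      exact ⟨φ, hφ, h'⟩
    · exact ⟨_root_.id, .id, fun l a ha => by simp [hs k l (not_lt.1 hk)] at ha⟩
  choose ψ hψ hψ' using key
  refine ⟨_, IsPlaneEmb.node he hψ, fun l a ha => ?_⟩
  cases l with
  | nil => exact hroot a ha
  | cons k l => exact hψ' k l a ha

/-- The finite trees: finitely many addresses, closed under prefixes. -/
def finiteTrees (X : Type*) : Set (List ℕ → Option X) :=
  {t | {l | t l ≠ none}.Finite ∧ ∀ l m, t l = none → t (l ++ m) = none}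

theorem subtree_mem_finiteTrees {X : Type*} {t : List ℕ → Option X} (ht : t ∈ finiteTrees X)
    (i : ℕ) : (fun l => t (i :: l)) ∈ finiteTrees X :=
  ⟨ht.1.preimage (f := List.cons i) (List.cons_injective.injOn), fun l m h => ht.2 (i :: l) m h⟩

theorem ncard_subtree_lt {X : Type*} {t : List ℕ → Option X} (ht : t ∈ finiteTrees X)
    (hroot : t [] ≠ none) (i : ℕ) :
    {l | t (i :: l) ≠ none}.ncard < {l | t l ≠ none}.ncard := by
  rw [← Set.ncard_image_of_injective (f := List.cons i) _ List.cons_injective]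
  refine Set.ncard_lt_ncard ⟨?_, fun h => ?_⟩ ht.1
  · rintro _ ⟨l, hl, rfl⟩
    exact hl
  · obtain ⟨l, -, hl⟩ := h (show [] ∈ {l | t l ≠ none} from hroot)
    simp at hl

theorem exists_children_bound {X : Type*} {t : List ℕ → Option X} (ht : t ∈ finiteTrees X) :
    ∃ m : ℕ, ∀ i l, m ≤ i → t (i :: l) = none := by
  obtain ⟨m, hm⟩ := (ht.1.image fun l => l.headD 0).bddAbove
  refine ⟨m + 1, fun i l hi => ?_⟩
  by_contra h
  have : i ≤ m := hm ⟨i :: l, h, rfl⟩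
  omega

/-- **Kruskal's tree theorem** for plane trees. -/
theorem kruskal {X : Type*} {r : X → X → Prop} [IsPreorder X r] (hr : WellQuasiOrdered r) :
    (finiteTrees X).PartiallyWellOrderedOn (Emb r) := by
  have := Emb.isPreorder r
  rw [Set.PartiallyWellOrderedOn.iff_not_exists_isMinBadSeq
    (fun t : List ℕ → Option X => {l | t l ≠ none}.ncard)]
  rintro ⟨f, ⟨hf, hbad⟩, hmin⟩
  have hroot : ∀ n, f n [] ≠ none := fun n h =>
    hbad n (n + 1) n.lt_succ_self ⟨_root_.id, .id, fun l a ha => by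
      simp [show f n l = none from (hf n).2 [] l h] at ha⟩
  have hsub : {s | ∃ n i, s = fun l => f n (i :: l)}.PartiallyWellOrderedOn (Emb r) := by
    rw [Set.PartiallyWellOrderedOn.iff_forall_not_isBadSeq]
    rintro g ⟨hg, hgbad⟩
    choose n i hgi using hg
    obtain ⟨m₀, hm₀⟩ : ∃ m₀, ∀ m, n m₀ ≤ n m :=
      ⟨Function.argmin n, fun m => Function.argmin_le n m⟩
    refine hmin (n m₀) (fun k => if k < n m₀ then f k else g (m₀ + (k - n m₀)))
      (fun k hk => (if_pos hk).symm) ?_ ⟨fun k => ?_, fun k k' hk h => ?_⟩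
    · simp only [lt_irrefl, if_false, Nat.sub_self, Nat.add_zero]
      rw [hgi m₀]
      exact ncard_subtree_lt (hf _) (hroot _) _
    · beta_reduce
      split_ifs
      · exact hf k
      · rw [hgi]
        exact subtree_mem_finiteTrees (hf _) _
    · beta_reduce at h
      by_cases h₁ : k' < n m₀
      · rw [if_pos h₁, if_pos (hk.trans h₁)] at h
        exact hbad k k' hk h
      · by_cases h₂ : k < n m₀
        · rw [if_pos h₂, if_neg h₁, hgi] at h
          exact hbad k _ (h₂.trans_le (hm₀ _)) (_root_.trans h (emb_subtree r _ _))
        · rw [if_neg h₁, if_neg h₂] at h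
          exact hgbad _ _ (by omega) h
  choose m hm using fun n => exists_children_bound (hf n)
  choose a ha using fun n => Option.ne_none_iff_exists'.1 (hroot n)
  obtain ⟨g, hg⟩ := hr.exists_monotone_subseq a
  obtain ⟨i, j, hij, h⟩ :=
    (hsub.partiallyWellOrderedOn_sublistForall₂ (Emb r)).exists_lt
      (f := fun n => (List.range (m (g n))).map fun i l => f (g n) (i :: l)) (by
        intro n s hs
        obtain ⟨i, -, rfl⟩ := List.mem_map.1 hs
        exact ⟨_, i, rfl⟩)
  refine hbad (g i) (g j) (g.strictMono hij)
    (emb_of_children (fun b hb => ?_) (hm (g i)) h)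
  obtain rfl : a (g i) = b := by simpa [ha] using hb
  exact ⟨_, ha _, hg i j hij.le⟩

end PlaneTree

namespace SimpleGraph

variable {V : Type} {G : SimpleGraph V}

theorem Walk.IsPath.append_of_inter {u v w : V} {p : G.Walk u v} {q : G.Walk v w}
    (hp : p.IsPath) (hq : q.IsPath) (h : ∀ z ∈ p.support, z ∈ q.support → z = v) :
    (p.append q).IsPath := by
  rw [Walk.isPath_def, Walk.support_append, List.nodup_append]
  have hq' := hq.support_nodup
  rw [← Walk.cons_tail_support, List.nodup_cons] at hq'
  refine ⟨hp.support_nodup, hq'.2, ?_⟩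
  rintro a ha b hb rfl
  obtain rfl := h a ha (List.mem_of_mem_tail hb)
  exact hq'.1 hb

/-- An addressing of the vertices of a graph by nonempty lists, making it a plane forest: the
parent of a vertex is obtained by dropping the last entry of its address. -/
structure IsAddressing (G : SimpleGraph V) (α : V → List ℕ) : Prop where
  injective : Function.Injective α
  ne_nil : ∀ v, α v ≠ []
  adj_iff : ∀ u v, G.Adj u v ↔ (∃ i, α v = α u ++ [i]) ∨ ∃ i, α u = α v ++ [i]
  exists_eq_of_isPrefix : ∀ v l, l ≠ [] → l <+: α v → ∃ w, α w = l

theorem IsAcyclic.support_eq (hG : G.IsAcyclic) {a b v w : V} (hab : a = b) (hvw : v = w)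
    {p : G.Walk a v} {q : G.Walk b w} (hp : p.IsPath) (hq : q.IsPath) :
    p.support = q.support := by
  subst hab hvw
  rw [show p = q from congrArg Subtype.val ((hG.subsingleton_path _ _).elim ⟨p, hp⟩ ⟨q, hq⟩)]

/-- Every acyclic graph is a plane forest. -/
theorem IsAcyclic.exists_isAddressing (hG : G.IsAcyclic) {f : V → ℕ} (hf : Function.Injective f) :
    ∃ α, G.IsAddressing α := by
  classical
  have hr : ∀ v, G.Reachable (G.connectedComponentMk v).out v := fun v =>
    ConnectedComponent.exact (Quot.out_eq _)
  choose p hp using fun v => (hr v).exists_isPath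
  have hroot : ∀ {u v}, G.Reachable u v →
      (G.connectedComponentMk u).out = (G.connectedComponentMk v).out := fun h => by
    rw [ConnectedComponent.sound h]
  have hlast : ∀ v, (p v).support.getLast? = some v := fun v => by
    rw [List.getLast?_eq_some_getLast (by simp), Walk.getLast_support]
  refine ⟨fun v => (p v).support.map f, ⟨fun u v h => ?_, fun v => by simp, fun u v => ?_, ?_⟩⟩
  · have h' := List.map_injective_iff.2 hf h
    have := hlast u
    rw [h', hlast v] at this
    exact (Option.some_injective _ this).symm
  · have haux : ∀ {u v}, G.Adj u v → v ∈ (p u).support →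
        (p u).support.map f = (p v).support.map f ++ [f u] := by
      intro u v huv hv
      have h₁ : ((p u).takeUntil v hv).support = (p v).support :=
        hG.support_eq (hroot huv.reachable) rfl ((hp u).takeUntil hv) (hp v)
      have h₂ : ((p u).dropUntil v hv).support = (Walk.cons huv.symm Walk.nil).support :=
        hG.support_eq rfl rfl ((hp u).dropUntil hv) (by simp [huv.ne'])
      conv_lhs => rw [← (p u).take_spec hv, Walk.support_append, h₁, h₂]
      simp
    have haux' : ∀ {u v i}, (p v).support.map f = (p u).support.map f ++ [i] → G.Adj u v := by
      intro u v i h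
      obtain ⟨l₁, l₂, h, h₁, h₂⟩ := List.map_eq_append_iff.1 h
      obtain rfl := List.map_injective_iff.2 hf h₁
      obtain ⟨x, rfl, -⟩ := List.map_eq_singleton_iff.1 h₂
      have hv := hlast v
      rw [h] at hv
      obtain rfl : x = v := by simpa using hv
      have hc := (p x).isChain_adj_support
      rw [h, List.isChain_append] at hc
      exact hc.2.2 u (by simp [hlast]) x (by simp)
    constructor
    · intro h
      by_cases hv : v ∈ (p u).support
      · exact Or.inr ⟨_, haux h hv⟩
      · refine Or.inl ⟨f v, ?_⟩
        have : (p v).support = ((p u).concat h).support :=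
          hG.support_eq (hroot h.symm.reachable) rfl (hp v) ((hp u).concat hv h)
        simp [this, Walk.support_concat]
    · rintro (⟨i, h⟩ | ⟨i, h⟩)
      · exact haux' h
      · exact (haux' h).symm
  · rintro v l hl h
    obtain ⟨l', hl', rfl⟩ : ∃ l', l' <+: (p v).support ∧ l = l'.map f := by
      obtain ⟨m, hm⟩ := h
      obtain ⟨l₁, l₂, h, h₁, -⟩ := List.map_eq_append_iff.1 hm.symm
      exact ⟨l₁, ⟨l₂, h.symm⟩, h₁.symm⟩
    obtain ⟨n, hn⟩ : ∃ n, l'.length = n + 1 :=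
      Nat.exists_eq_succ_of_ne_zero fun h => hl (by simp [List.length_eq_zero_iff.1 h])
    have hl'' : l' = ((p v).take n).support := by
      rw [Walk.support_take, ← hn]
      exact List.prefix_iff_eq_take.1 hl'
    refine ⟨(p v).getVert n, ?_⟩
    rw [hl'', hG.support_eq 
      (hroot (((p v).take n).reachable.symm.trans (hr v))) rfl (hp _) ((hp v).take n)]

theorem IsAddressing.exists_path {α : V → List ℕ} (h : G.IsAddressing α) {x y : V}
    (hxy : α x <+: α y) :
    ∃ p : G.Walk x y, p.IsPath ∧ ∀ z, z ∈ p.support ↔ α x <+: α z ∧ α z <+: α y := by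
  obtain ⟨t, ht⟩ := hxy
  induction t using List.reverseRecOn generalizing y with
  | nil =>
    obtain rfl : x = y := h.injective (by simpa using ht)
    refine ⟨.nil, .nil, fun z => ?_⟩
    simp only [Walk.support_nil, List.mem_singleton]
    constructor
    · rintro rfl
      simp
    · rintro ⟨h₁, h₂⟩
      exact h.injective (h₂.eq_of_length_le h₁.length_le)
  | append_singleton t i ih =>
    obtain ⟨w, hw⟩ := h.exists_eq_of_isPrefix y (α x ++ t) (by simp [h.ne_nil])
      ⟨[i], by simpa using ht⟩
    obtain ⟨p, hp, hsupp⟩ := ih hw.symm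
    have hy : α y = α w ++ [i] := by rw [hw, ← ht, List.append_assoc]
    have hadj : G.Adj w y := (h.adj_iff w y).2 (Or.inl ⟨i, hy⟩)
    refine ⟨p.concat hadj, hp.concat ?_ hadj, fun z => ?_⟩
    · rw [hsupp]
      rintro ⟨-, h'⟩
      have := h'.length_le
      simp [hy] at this
    · rw [Walk.support_concat, List.mem_append, hsupp, hy, List.prefix_concat_iff, ← hy,
        h.injective.eq_iff, List.mem_singleton]
      constructor
      · rintro (h' | rfl)
        · exact ⟨h'.1, Or.inr h'.2⟩
        · exact ⟨⟨_, ht⟩, Or.inl rfl⟩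
      · tauto

end SimpleGraph

section Paths

variable {V : Type} {G : SimpleGraph V}

theorem PathQ.exists_walk (P : PathQ G) {x y : V} (h : P.ends = s(x, y)) :
    ∃ (p : G.Walk x y) (hp : p.IsPath), P = Quotient.mk (revSetoid G) ⟨x, y, p, hp⟩ := by
  induction P using Quotient.inductionOn with
  | h q =>
    obtain ⟨a, b, p, hp⟩ := q
    rcases Sym2.eq_iff.1 (show s(a, b) = s(x, y) from h) with ⟨rfl, rfl⟩ | ⟨rfl, rfl⟩
    · exact ⟨p, hp, rfl⟩
    · exact ⟨p.reverse, hp.reverse, Quotient.sound (Or.inr (OPath.rev_rev _).symm)⟩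

theorem PathQ.ext_of_isAcyclic (hG : G.IsAcyclic) {P Q : PathQ G} (h : P.ends = Q.ends) :
    P = Q := by
  obtain ⟨x, y, hxy⟩ : ∃ x y, Q.ends = s(x, y) :=
    ⟨_, _, (Quot.out_eq Q.ends).symm⟩
  obtain ⟨p, hp, rfl⟩ := Q.exists_walk hxy
  obtain ⟨q, hq, rfl⟩ := P.exists_walk (h.trans hxy)
  obtain rfl : q = p := congrArg Subtype.val ((hG.subsingleton_path _ _).elim ⟨q, hq⟩ ⟨p, hp⟩)
  rfl

end Paths

namespace TMHom

variable {V V' V'' : Type} {G : SimpleGraph V} {G' : SimpleGraph V'} {G'' : SimpleGraph V''}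

theorem exists_shared (ρ : TMHom G G') {e₁ e₂ : G.edgeSet} (h : e₁ ≠ e₂) {z : V'}
    (h₁ : z ∈ (ρ.toFunE e₁).suppSet) (h₂ : z ∈ (ρ.toFunE e₂).suppSet) :
    ∃ v, v ∈ (e₁ : Sym2 V) ∧ v ∈ (e₂ : Sym2 V) ∧ z = ρ.toFunV v := by
  by_cases hv : ∃ v : V, v ∈ (e₁ : Sym2 V) ∧ v ∈ (e₂ : Sym2 V)
  · obtain ⟨v, hv₁, hv₂⟩ := hv
    have : z ∈ (ρ.toFunE e₁).suppSet ∩ (ρ.toFunE e₂).suppSet := ⟨h₁, h₂⟩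
    rw [ρ.inter_shared e₁ e₂ h v hv₁ hv₂] at this
    exact ⟨v, hv₁, hv₂, this⟩
  · have : z ∈ (ρ.toFunE e₁).suppSet ∩ (ρ.toFunE e₂).suppSet := ⟨h₁, h₂⟩
    rw [ρ.inter_disjoint e₁ e₂ h (not_exists.1 hv)] at this
    exact this.elim

/-- A topological minor morphism from the property that image paths of distinct edges only meet in
images of common endpoints. -/
def ofShared (f : V → V') (E : G.edgeSet → PathQ G') (hf : Function.Injective f)
    (hE : ∀ e, (E e).ends = Sym2.map f (e : Sym2 V))
    (hmem : ∀ (e : G.edgeSet) (v : V), f v ∈ (E e).suppSet ↔ v ∈ (e : Sym2 V))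
    (hshared : ∀ e₁ e₂ : G.edgeSet, e₁ ≠ e₂ → ∀ z, z ∈ (E e₁).suppSet → z ∈ (E e₂).suppSet →
      ∃ v, v ∈ (e₁ : Sym2 V) ∧ v ∈ (e₂ : Sym2 V) ∧ z = f v) : TMHom G G' where
  toFunV := f
  toFunE := E
  injV := hf
  ends_eq := hE
  mem_iff := hmem
  inter_shared := by
    intro e₁ e₂ h v h₁ h₂
    ext z
    constructor
    · rintro ⟨hz₁, hz₂⟩
      obtain ⟨w, hw₁, hw₂, rfl⟩ := hshared e₁ e₂ h z hz₁ hz₂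
      by_contra hne
      have hvw : v ≠ w := fun h => hne (by simp [h])
      exact h (Subtype.ext (((Sym2.mem_and_mem_iff hvw).1 ⟨h₁, hw₁⟩).trans
        ((Sym2.mem_and_mem_iff hvw).1 ⟨h₂, hw₂⟩).symm))
    · rintro rfl
      exact ⟨(hmem _ _).2 h₁, (hmem _ _).2 h₂⟩
  inter_disjoint := by
    intro e₁ e₂ h hv
    ext z
    simp only [Set.mem_inter_iff, Set.mem_empty_iff_false, iff_false]
    rintro ⟨hz₁, hz₂⟩
    obtain ⟨w, hw₁, hw₂, -⟩ := hshared e₁ e₂ h z hz₁ hz₂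
    exact hv w ⟨hw₁, hw₂⟩

theorem exists_map_path (σ : TMHom G' G'') {a b : V'} (p : G'.Walk a b) (hp : p.IsPath) :
    ∃ q : G''.Walk (σ.toFunV a) (σ.toFunV b), q.IsPath ∧
      (∀ x, x ∈ q.edges ↔ ∃ e : G'.edgeSet, (e : Sym2 V') ∈ p.edges ∧
        x ∈ (σ.toFunE e).edgesSet) ∧
      ∀ z, z ∈ q.support ↔ z = σ.toFunV a ∨ ∃ e : G'.edgeSet, (e : Sym2 V') ∈ p.edges ∧
        z ∈ (σ.toFunE e).suppSet := by
  induction p with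
  | nil => exact ⟨.nil, .nil, by simp, by simp⟩
  | @cons a c b hac p ih =>
    rw [SimpleGraph.Walk.cons_isPath_iff] at hp
    obtain ⟨q, hq, hedges, hsupp⟩ := ih hp.1
    have hends := σ.ends_eq ⟨s(a, c), hac⟩
    rw [Sym2.map_mk] at hends
    obtain ⟨P, hP, hPeq⟩ := PathQ.exists_walk _ hends
    have hPs : ∀ z, z ∈ (σ.toFunE ⟨s(a, c), hac⟩).suppSet ↔ z ∈ P.support := fun z => by
      rw [hPeq]; rfl
    have hPe : ∀ z, z ∈ (σ.toFunE ⟨s(a, c), hac⟩).edgesSet ↔ z ∈ P.edges := fun z => by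
      rw [hPeq]; rfl
    refine ⟨P.append q, hP.append_of_inter hq fun z hz hz' => ?_, fun x => ?_, fun z => ?_⟩
    · rcases (hsupp z).1 hz' with rfl | ⟨e, he, hze⟩
      · rfl
      · have hne : (⟨s(a, c), hac⟩ : G'.edgeSet) ≠ e := by
          rintro rfl
          exact hp.2 (p.fst_mem_support_of_mem_edges he)
        obtain ⟨v, hv, hv', rfl⟩ := σ.exists_shared hne ((hPs z).2 hz) hze
        rcases Sym2.mem_iff.1 hv with rfl | rfl
        · exact absurd (SimpleGraph.Walk.mem_support_of_mem_edges he hv') hp.2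
        · rfl
    · rw [SimpleGraph.Walk.edges_append, List.mem_append, hedges, ← hPe]
      simp only [SimpleGraph.Walk.edges_cons, List.mem_cons]
      constructor
      · rintro (h | ⟨e, he, h⟩)
        · exact ⟨_, Or.inl rfl, h⟩
        · exact ⟨e, Or.inr he, h⟩
      · rintro ⟨⟨e, he'⟩, rfl | he, h⟩
        · exact Or.inl h
        · exact Or.inr ⟨_, he, h⟩
    · rw [SimpleGraph.Walk.mem_support_append_iff, hsupp, ← hPs]
      simp only [SimpleGraph.Walk.edges_cons, List.mem_cons]
      have ha : σ.toFunV a ∈ (σ.toFunE ⟨s(a, c), hac⟩).suppSet := by simp [σ.mem_iff]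
      have hc : σ.toFunV c ∈ (σ.toFunE ⟨s(a, c), hac⟩).suppSet := by simp [σ.mem_iff]
      constructor
      · rintro (h | rfl | ⟨e, he, h⟩)
        · exact Or.inr ⟨_, Or.inl rfl, h⟩
        · exact Or.inr ⟨_, Or.inl rfl, hc⟩
        · exact Or.inr ⟨e, Or.inr he, h⟩
      · rintro (rfl | ⟨⟨e, he'⟩, rfl | he, h⟩)
        · exact Or.inl ha
        · exact Or.inl h
        · exact Or.inr (Or.inr ⟨_, he, h⟩)

theorem exists_comp (ρ : TMHom G G') (σ : TMHom G' G'') :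
    ∃ τ : TMHom G G'', τ.toFunV = σ.toFunV ∘ ρ.toFunV ∧
      ∀ e : G.edgeSet, (τ.toFunE e).edgesSet =
        {x : Sym2 V'' | ∃ e' : G'.edgeSet,
          (e' : Sym2 V') ∈ (ρ.toFunE e).edgesSet ∧ x ∈ (σ.toFunE e').edgesSet} := by
  have key : ∀ e : G.edgeSet, ∃ P : PathQ G'',
      P.ends = Sym2.map (σ.toFunV ∘ ρ.toFunV) (e : Sym2 V) ∧
      P.edgesSet = {x : Sym2 V'' | ∃ e' : G'.edgeSet,
          (e' : Sym2 V') ∈ (ρ.toFunE e).edgesSet ∧ x ∈ (σ.toFunE e').edgesSet} ∧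
      P.suppSet = {z | ∃ e' : G'.edgeSet,
          (e' : Sym2 V') ∈ (ρ.toFunE e).edgesSet ∧ z ∈ (σ.toFunE e').suppSet} ∧
      ∀ w, w ∈ (ρ.toFunE e).suppSet ↔ ∃ e' : G'.edgeSet,
          (e' : Sym2 V') ∈ (ρ.toFunE e).edgesSet ∧ w ∈ (e' : Sym2 V') := by
    rintro ⟨e, he⟩
    induction e using Sym2.ind with
    | _ u v =>
      have hends := ρ.ends_eq ⟨s(u, v), he⟩
      rw [Sym2.map_mk] at hends
      obtain ⟨p, hp, hpeq⟩ := PathQ.exists_walk _ hends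
      obtain ⟨q, hq, hqe, hqs⟩ := σ.exists_map_path p hp
      have hnil : ¬ p.Nil := SimpleGraph.Walk.not_nil_of_ne (ρ.injV.ne (G.ne_of_adj he))
      rw [hpeq]
      refine ⟨Quotient.mk _ ⟨_, _, q, hq⟩, rfl, Set.ext hqe, ?_, fun w => ?_⟩
      · ext z
        refine (hqs z).trans ⟨?_, Or.inr⟩
        rintro (rfl | h)
        · refine ⟨⟨s(_, p.snd), p.adj_snd hnil⟩, p.mk_start_snd_mem_edges hnil, ?_⟩
          simp [σ.mem_iff]
        · exact h
      · constructor
        · intro hw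
          obtain ⟨e', he', hwe'⟩ :=
            (SimpleGraph.Walk.mem_support_iff_exists_mem_edges_of_not_nil hnil).1 hw
          exact ⟨⟨e', p.edges_subset_edgeSet he'⟩, he', hwe'⟩
        · rintro ⟨e', he', hwe'⟩
          exact SimpleGraph.Walk.mem_support_of_mem_edges he' hwe'
  choose P hends hedges hsupp hρ using key
  refine ⟨ofShared _ P (σ.injV.comp ρ.injV) hends (fun e v => ?_) (fun e₁ e₂ hne z h₁ h₂ => ?_),
    rfl, hedges⟩
  · rw [hsupp, ← ρ.mem_iff, hρ]
    simp [σ.mem_iff]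
  · rw [hsupp] at h₁ h₂
    obtain ⟨e₁', he₁', h₁⟩ := h₁
    obtain ⟨e₂', he₂', h₂⟩ := h₂
    have hne' : e₁' ≠ e₂' := by
      rintro rfl
      obtain ⟨e, he⟩ := e₁'
      induction e using Sym2.ind with
      | _ x y =>
        have hx := ρ.exists_shared hne
          ((hρ _ x).2 ⟨_, he₁', by simp⟩) ((hρ _ x).2 ⟨_, he₂', by simp⟩)
        have hy := ρ.exists_shared hne
          ((hρ _ y).2 ⟨_, he₁', by simp⟩) ((hρ _ y).2 ⟨_, he₂', by simp⟩)
        obtain ⟨v, hv₁, hv₂, rfl⟩ := hx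
        obtain ⟨w, hw₁, hw₂, rfl⟩ := hy
        have hvw : v ≠ w := fun h => G'.ne_of_adj he (by rw [h])
        exact hne (Subtype.ext (((Sym2.mem_and_mem_iff hvw).1 ⟨hv₁, hw₁⟩).trans
          ((Sym2.mem_and_mem_iff hvw).1 ⟨hv₂, hw₂⟩).symm))
    obtain ⟨w, hw₁, hw₂, rfl⟩ := σ.exists_shared hne' h₁ h₂
    obtain ⟨v, hv₁, hv₂, rfl⟩ :=
      ρ.exists_shared hne ((hρ _ w).2 ⟨_, he₁', hw₁⟩) ((hρ _ w).2 ⟨_, he₂', hw₂⟩)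
    exact ⟨v, hv₁, hv₂, rfl⟩

/-- An embedding of plane forests is a topological minor morphism. -/
theorem exists_of_isPlaneEmb {α : V → List ℕ} (hα : G.IsAddressing α) {α' : V' → List ℕ}
    (hα' : G'.IsAddressing α') {φ : List ℕ → List ℕ} (hφ : PlaneTree.IsPlaneEmb φ) {h : V → V'}
    (hh : ∀ v, α' (h v) = φ (α v)) : ∃ τ : TMHom G G', τ.toFunV = h := by
  have hinj : Function.Injective h := fun u v huv =>
    hα.injective (hφ.strictMono.injective (by rw [← hh, ← hh, huv]))
  have key : ∀ e : G.edgeSet, ∃ P : PathQ G', ∃ x y : V, ∃ i : ℕ,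
      P.ends = Sym2.map h (e : Sym2 V) ∧ (e : Sym2 V) = s(x, y) ∧ α y = α x ++ [i] ∧
      ∀ z, z ∈ P.suppSet ↔ φ (α x) <+: α' z ∧ α' z <+: φ (α y) := by
    have aux : ∀ {x y : V} {i : ℕ}, α y = α x ++ [i] → ∃ P : PathQ G',
        P.ends = s(h x, h y) ∧
        ∀ z, z ∈ P.suppSet ↔ φ (α x) <+: α' z ∧ α' z <+: φ (α y) := by
      intro x y i hxy
      obtain ⟨p, hp, hsupp⟩ := hα'.exists_path (x := h x) (y := h y) (by
        rw [hh, hh, hφ.prefix_iff]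
        exact ⟨_, hxy.symm⟩)
      rw [hh, hh] at hsupp
      exact ⟨Quotient.mk _ ⟨_, _, p, hp⟩, rfl, hsupp⟩
    rintro ⟨e, he⟩
    induction e using Sym2.ind with
    | _ u v =>
      rcases (hα.adj_iff u v).1 he with ⟨i, hi⟩ | ⟨i, hi⟩
      · obtain ⟨P, hP, hP'⟩ := aux hi
        exact ⟨P, u, v, i, hP, rfl, hi, hP'⟩
      · obtain ⟨P, hP, hP'⟩ := aux hi
        exact ⟨P, v, u, i, hP.trans Sym2.eq_swap, Sym2.eq_swap, hi, hP'⟩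
  choose P x y i hends he hxy hsupp using key
  have hle : ∀ e l, l <+: α (y e) → l = α (y e) ∨ l <+: α (x e) := fun e l hl => by
    rwa [hxy, List.prefix_concat_iff, ← hxy] at hl
  refine ⟨ofShared h P hinj hends (fun e v => ?_) (fun e₁ e₂ hne z h₁ h₂ => ?_), rfl⟩
  · rw [hsupp, hh, hφ.prefix_iff, hφ.prefix_iff, he, Sym2.mem_iff]
    constructor
    · rintro ⟨h₁, h₂⟩
      rcases hle _ _ h₂ with h₂ | h₂
      · exact Or.inr (hα.injective h₂)
      · exact Or.inl (hα.injective (h₂.eq_of_length_le h₁.length_le))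
    · rintro (rfl | rfl)
      · exact ⟨List.prefix_refl _, ⟨_, (hxy e).symm⟩⟩
      · exact ⟨⟨_, (hxy e).symm⟩, List.prefix_refl _⟩
  · rw [hsupp] at h₁ h₂
    have hz : ∀ e v, φ (α (x e)) <+: α' z → α' z <+: φ (α v) → α v <+: α (x e) →
        z = h v ∧ v = x e := by
      intro e v h₁ h₂ h₃
      have hv : v = x e :=
        hα.injective (h₃.eq_of_length_le (hφ.prefix_iff.1 (h₁.trans h₂)).length_le)
      refine ⟨hα'.injective ?_, hv⟩
      subst hv
      rw [hh]
      exact h₂.eq_of_length_le h₁.length_le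
    have hlcp := PlaneTree.prefix_lcp_iff.2 ⟨h₁.2, h₂.2⟩
    rw [hφ.map_lcp] at hlcp
    set m := PlaneTree.lcp (α (y e₁)) (α (y e₂)) with hm
    obtain ⟨hm₁, hm₂⟩ := PlaneTree.prefix_lcp_iff.1 (List.prefix_refl m)
    have hm₀ : m ≠ [] := by
      intro h0
      have := (hφ.prefix_iff.1 (h₁.1.trans hlcp))
      rw [h0, List.prefix_nil] at this
      exact hα.ne_nil _ this
    obtain ⟨v, hv⟩ := hα.exists_eq_of_isPrefix _ m hm₀ hm₁
    rw [← hv] at hm₁ hm₂ hlcp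
    rcases hle _ _ hm₁ with h₁' | h₁' <;> rcases hle _ _ hm₂ with h₂' | h₂'
    · exfalso
      have hyy : y e₁ = y e₂ := hα.injective (h₁'.symm.trans h₂')
      have hxx : x e₁ = x e₂ := hα.injective (List.append_inj_left'
        (((hxy e₁).symm.trans (by rw [hyy])).trans (hxy e₂)) rfl)
      exact hne (Subtype.ext (by rw [he, he, hyy, hxx]))
    · obtain ⟨hzv, hvx⟩ := hz e₂ v h₂.1 hlcp h₂'
      refine ⟨v, ?_, ?_, hzv⟩
      · simp [he e₁, hα.injective h₁']
      · simp [he e₂, hvx]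
    · obtain ⟨hzv, hvx⟩ := hz e₁ v h₁.1 hlcp h₁'
      refine ⟨v, ?_, ?_, hzv⟩
      · simp [he e₁, hvx]
      · simp [he e₂, hα.injective h₂']
    · obtain ⟨hzv, hvx⟩ := hz e₁ v h₁.1 hlcp h₁'
      obtain ⟨-, hvx'⟩ := hz e₂ v h₂.1 hlcp h₂'
      refine ⟨v, ?_, ?_, hzv⟩
      · rw [he e₁, hvx]; simp
      · rw [he e₂, hvx']; simp

end TMHom

namespace LFHom

variable {Q : Type} [Preorder Q]

theorem ext_toFunV {T T' : LForest Q} {f g : LFHom T T'} (h : f.toFunV = g.toFunV) : f = g := by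
  obtain ⟨⟨fV, fE, _, fends, _, _, _⟩, _⟩ := f
  obtain ⟨⟨gV, gE, _, gends, _, _, _⟩, _⟩ := g
  obtain rfl : fV = gV := h
  obtain rfl : fE = gE :=
    funext fun e => PathQ.ext_of_isAcyclic T'.acyclic ((fends e).trans (gends e).symm)
  rfl

instance {T T' : LForest Q} : Finite (LFHom T T') :=
  Finite.of_injective (fun f : LFHom T T' => f.toFunV) fun _ _ => ext_toFunV

theorem exists_comp {T T' T'' : LForest Q} (ρ : LFHom T T') (σ : LFHom T' T'') :
    ∃ τ : LFHom T T'', τ.toFunV = σ.toFunV ∘ ρ.toFunV ∧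
      ∀ (A : Type) [CommRing A] (𝓜 : LFMod Q A), 𝓜.act τ = 𝓜.act σ ∘ₗ 𝓜.act ρ := by
  obtain ⟨τ, hV, hE⟩ := TMHom.exists_comp ρ.toTMHom σ.toTMHom
  refine ⟨⟨τ, fun v => ?_⟩, hV, fun A _ 𝓜 => 𝓜.act_comp ρ σ _ hV hE⟩
  rw [hV]
  exact (ρ.label_le v).trans (σ.label_le _)

end LFHom

namespace GroebnerModule

variable {Ob : Type*} {A : Type*} [CommRing A] {M : Ob → Type*}
  [∀ T, AddCommGroup (M T)] [∀ T, Module A (M T)] {ι : Ob → Type*} [∀ T, LinearOrder (ι T)]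

/-- The coefficients at `s` of the linear combinations of the generators `g` that lie in `N` and
whose leading index is at most `s`. -/
noncomputable def leadingIdeal {T : Ob} (g : ι T → M T) (N : Submodule A (M T)) (s : ι T) :
    Ideal A :=
  (N.comap (Finsupp.linearCombination A g) ⊓ Finsupp.supported A A (Set.Iic s)).map
    (Finsupp.lapply s)

theorem mem_leadingIdeal {T : Ob} {g : ι T → M T} {N : Submodule A (M T)} {s : ι T} {a : A} :
    a ∈ leadingIdeal g N s ↔ ∃ c : ι T →₀ A, Finsupp.linearCombination A g c ∈ N ∧
      (∀ x ∈ c.support, x ≤ s) ∧ c s = a := by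
  simp only [leadingIdeal, Submodule.mem_map, Submodule.mem_inf, Submodule.mem_comap,
    Finsupp.mem_supported, and_assoc, Finsupp.lapply_apply]
  rfl

/-- The index `s'` at `T'` is the image of the index `s` at `T` under a strictly monotone map of
indices induced by a map in `act`. -/
def Divides (act : ∀ T T', Set (M T →ₗ[A] M T')) (g : ∀ T, ι T → M T) (s s' : Σ T, ι T) : Prop :=
  ∃ H ∈ act s.1 s'.1, ∃ h : ι s.1 → ι s'.1, StrictMono h ∧ (∀ x, H (g _ x) = g _ (h x)) ∧
    h s.2 = s'.2

theorem exists_finset_generating [IsNoetherianRing A] [∀ T, Finite (ι T)]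
    (act : ∀ T T', Set (M T →ₗ[A] M T')) (g : ∀ T, ι T → M T)
    (hg : ∀ T, Submodule.span A (Set.range (g T)) = ⊤)
    (N : ∀ T, Submodule A (M T)) (hN : ∀ T T', ∀ H ∈ act T T', ∀ x ∈ N T, H x ∈ N T')
    (hwqo : ∀ s : ℕ → Σ T, ι T, ∃ e : ℕ ↪o ℕ, ∀ i j, i < j →
      Divides act g (s (e i)) (s (e j))) :
    ∃ F : Finset Ob, ∀ T', ∀ y ∈ N T',
      y ∈ Submodule.span A {z | ∃ T ∈ F, ∃ x ∈ N T, ∃ H ∈ act T T', z = H x} := by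
  classical
  let I : (Σ T, ι T) → Ideal A := fun s => leadingIdeal (g s.1) (N s.1) s.2
  obtain ⟨F, hF⟩ : ∃ F : Finset (Σ T, ι T), ∀ s, ∃ s₀ ∈ F, Divides act g s₀ s ∧ I s ≤ I s₀ := by
    by_contra! hcon
    obtain ⟨s, -, hs⟩ := exists_seq_of_forall_finset_exists (fun _ : Σ T, ι T => True)
      (fun s₀ s => Divides act g s₀ s → ¬ I s ≤ I s₀)
      (fun F _ => (hcon F).imp fun s hs => ⟨trivial, hs⟩)
    obtain ⟨e, he⟩ := hwqo s
    have hmono : Monotone fun n => I (s (e n)) := by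
      refine monotone_nat_of_le_succ fun n a ha => ?_
      obtain ⟨H, hH, h, hh, hHg, hs'⟩ := he n (n + 1) n.lt_succ_self
      obtain ⟨c, hc, hsupp, rfl⟩ := mem_leadingIdeal.1 ha
      refine mem_leadingIdeal.2 ⟨c.mapDomain h, ?_, fun x hx => ?_, ?_⟩
      · have := hN _ _ H hH _ hc
        rw [Finsupp.linearCombination_mapDomain]
        rw [Finsupp.apply_linearCombination] at this
        rwa [show g _ ∘ h = H ∘ g _ from funext fun x => (hHg x).symm]
      · obtain ⟨y, hy, rfl⟩ := Finset.mem_image.1 (Finsupp.mapDomain_support hx)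
        rw [← hs']
        exact hh.monotone (hsupp y hy)
      · rw [← hs', Finsupp.mapDomain_apply hh.injective]
    obtain ⟨n, hn⟩ := monotone_stabilizes_iff_noetherian.2 ‹IsNoetherianRing A› ⟨_, hmono⟩
    exact hs (e n) (e (n + 1)) (e.strictMono n.lt_succ_self) (he n (n + 1) n.lt_succ_self)
      (hn (n + 1) n.le_succ).ge
  refine ⟨F.image Sigma.fst, fun T' => ?_⟩
  set S := Submodule.span A
    {z : M T' | ∃ T ∈ F.image Sigma.fst, ∃ x ∈ N T, ∃ H ∈ act T T', z = H x} with hS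
  have key : ∀ (s : ι T') (c : ι T' →₀ A), (∀ x ∈ c.support, x ≤ s) →
      Finsupp.linearCombination A (g T') c ∈ N T' →
      Finsupp.linearCombination A (g T') c ∈ S := by
    intro s
    induction s using WellFoundedLT.induction with
    | ind s ih =>
      intro c hsupp hc
      obtain ⟨s₀, hs₀, ⟨H, hH, h, hh, hHg, hs'⟩, hI⟩ := hF ⟨T', s⟩
      obtain ⟨c₀, hc₀, hsupp₀, hcs⟩ := mem_leadingIdeal.1
        (hI (mem_leadingIdeal.2 ⟨c, hc, hsupp, rfl⟩ : c s ∈ I ⟨T', s⟩))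
      dsimp only at hs' h hh hHg hH
      have hmap : Finsupp.linearCombination A (g T') (c₀.mapDomain h) =
          H (Finsupp.linearCombination A (g s₀.1) c₀) := by
        rw [Finsupp.linearCombination_mapDomain, Finsupp.apply_linearCombination,
          show g _ ∘ h = H ∘ g _ from funext fun x => (hHg x).symm]
      have hmem : H (Finsupp.linearCombination A (g s₀.1) c₀) ∈ S :=
        Submodule.subset_span ⟨s₀.1, Finset.mem_image_of_mem _ hs₀, _, hc₀, H, hH, rfl⟩
      have hdecomp : Finsupp.linearCombination A (g T') c =
          Finsupp.linearCombination A (g T') (c - c₀.mapDomain h) +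
            H (Finsupp.linearCombination A (g s₀.1) c₀) := by
        rw [map_sub, hmap, sub_add_cancel]
      have hlt : ∀ x ∈ (c - c₀.mapDomain h).support, x < s := by
        intro x hx
        refine lt_of_le_of_ne ?_ ?_
        · rcases Finset.mem_union.1 (Finsupp.support_sub hx) with hx | hx
          · exact hsupp x hx
          · obtain ⟨y, hy, rfl⟩ := Finset.mem_image.1 (Finsupp.mapDomain_support hx)
            rw [← hs']
            exact hh.monotone (hsupp₀ y hy)
        · rintro rfl
          rw [Finsupp.mem_support_iff, Finsupp.sub_apply, ← hs',
            Finsupp.mapDomain_apply hh.injective, hcs, hs', sub_self] at hx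
          exact hx rfl
      have hN' : Finsupp.linearCombination A (g T') (c - c₀.mapDomain h) ∈ N T' := by
        rw [map_sub, hmap]
        exact sub_mem hc (hN _ _ H hH _ hc₀)
      rw [hdecomp]
      refine add_mem ?_ hmem
      rcases (c - c₀.mapDomain h).support.eq_empty_or_nonempty with h0 | hne
      · rw [Finsupp.support_eq_empty.1 h0, map_zero]
        exact zero_mem _
      · exact ih _ (hlt _ (Finset.max'_mem _ hne)) _ (fun x hx => Finset.le_max' _ x hx) hN'
  intro y hy
  have hy' : y ∈ Submodule.span A (Set.range (g T')) := hg T' ▸ Submodule.mem_top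
  obtain ⟨c, rfl⟩ := (Finsupp.mem_span_range_iff_exists_finsupp).1 hy'
  change Finsupp.linearCombination A (g T') c ∈ N T' at hy
  change Finsupp.linearCombination A (g T') c ∈ S
  rcases c.support.eq_empty_or_nonempty with h0 | hne
  · rw [Finsupp.support_eq_empty.1 h0, map_zero]
    exact zero_mem _
  · exact key (c.support.max' hne) c (fun x hx => Finset.le_max' _ x hx) hy

end GroebnerModule

theorem WellQuasiOrdered.sum {X Y : Type*} {r : X → X → Prop} {s : Y → Y → Prop}
    (hr : WellQuasiOrdered r) (hs : WellQuasiOrdered s) : WellQuasiOrdered (Sum.LiftRel r s) := by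
  rw [← Set.partiallyWellOrderedOn_univ_iff] at hr hs ⊢
  rw [← Set.range_inl_union_range_inr, ← Set.image_univ, ← Set.image_univ]
  exact (hr.image_of_monotone_on fun _ _ _ _ => .inl).union
    (hs.image_of_monotone_on fun _ _ _ _ => .inr)

namespace SimpleGraph.IsAddressing

open Classical in
/-- The rooted plane tree obtained from the labeled plane forest given by an addressing `α` and
the labels `lab` by adding a root with label `root`. -/
noncomputable def code {V : Type} {X : Type*} (root : X) (α : V → List ℕ) (lab : V → X)
    (l : List ℕ) : Option X :=
  if l = [] then some root else if h : ∃ v, α v = l then some (lab h.choose) else none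

variable {V : Type} {X : Type*} {G : SimpleGraph V} {α : V → List ℕ} {root : X} {lab : V → X}

theorem code_apply (hα : G.IsAddressing α) (v : V) : code root α lab (α v) = some (lab v) := by
  have h : ∃ w, α w = α v := ⟨v, rfl⟩
  rw [code, if_neg (hα.ne_nil v), dif_pos h, hα.injective h.choose_spec]

theorem eq_of_code_eq_some {l : List ℕ} {x : X} (h : code root α lab l = some x) :
    (l = [] ∧ x = root) ∨ ∃ v, α v = l ∧ x = lab v := by
  unfold code at h
  split_ifs at h with h₁ h₂
  · exact .inl ⟨h₁, (Option.some.inj h).symm⟩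
  · exact .inr ⟨_, h₂.choose_spec, (Option.some.inj h).symm⟩

theorem code_mem_finiteTrees [Finite V] (hα : G.IsAddressing α) :
    code root α lab ∈ PlaneTree.finiteTrees X := by
  refine ⟨((Set.finite_range α).insert []).subset fun l hl => ?_, fun l m hl => ?_⟩
  · obtain ⟨x, hx⟩ := Option.ne_none_iff_exists'.1 hl
    obtain ⟨rfl, -⟩ | ⟨v, rfl, -⟩ := eq_of_code_eq_some hx
    · exact Set.mem_insert _ _
    · exact Set.mem_insert_of_mem _ (Set.mem_range_self v)
  · by_contra hlm
    obtain ⟨x, hx⟩ := Option.ne_none_iff_exists'.1 hlm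
    have hl' : l ≠ [] := by
      rintro rfl
      simp [code] at hl
    obtain ⟨h, -⟩ | ⟨v, hv, -⟩ := eq_of_code_eq_some hx
    · exact hl' (List.append_eq_nil_iff.1 h).1
    · obtain ⟨w, rfl⟩ := hα.exists_eq_of_isPrefix v l hl' (hv ▸ List.prefix_append l m)
      rw [hα.code_apply] at hl
      simp at hl

end SimpleGraph.IsAddressing

theorem List.map_lt_map_of_strictMono {X Y : Type*} [LinearOrder X] [LinearOrder Y] {φ : X → Y}
    (hφ : StrictMono φ) {l m : List X} (h : l < m) : l.map φ < m.map φ := by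
  induction l generalizing m with
  | nil =>
    cases m with
    | nil => exact absurd h (lt_irrefl _)
    | cons b m => exact List.nil_lt_cons _ _
  | cons a l ih =>
    cases m with
    | nil => exact absurd h (List.not_lt_nil _)
    | cons b m =>
      rw [List.map_cons, List.map_cons, List.cons_lt_cons_iff]
      exact (List.cons_lt_cons_iff.1 h).imp (fun h => hφ h) fun h => ⟨congrArg φ h.1, ih h.2⟩

namespace LForest

variable {Q : Type}

theorem exists_isAddressing (T : LForest Q) : ∃ α, T.graph.IsAddressing α :=
  T.acyclic.exists_isAddressing Fin.val_injective

/-- A choice of an addressing of the vertices of a forest. -/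
noncomputable def addr (T : LForest Q) : Fin T.n → List ℕ := T.exists_isAddressing.choose

theorem isAddressing_addr (T : LForest Q) : T.graph.IsAddressing T.addr :=
  T.exists_isAddressing.choose_spec

variable [Preorder Q] {k : ℕ} (T₀ : Fin k → LForest Q)

/-- The indices of the spanning set at `T` of a module generated by elements at the `T₀ j`. -/
abbrev Index (T : LForest Q) : Type := Σ j : Fin k, LFHom (T₀ j) T

variable {T₀}

/-- The sequence of addresses that determines the position of an index in the linear order. -/
noncomputable def Index.key {T : LForest Q} (s : Index T₀ T) : List (List ℕ) :=
  [(s.1 : ℕ)] :: List.ofFn fun v => T.addr (s.2.toFunV v)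

theorem Index.key_injective {T : LForest Q} :
    Function.Injective (Index.key (T₀ := T₀) (T := T)) := by
  rintro ⟨j, f⟩ ⟨j', f'⟩ h
  obtain ⟨h₁, h₂⟩ := List.cons.inj h
  obtain rfl : j = j' := Fin.ext (by simpa using h₁)
  obtain rfl : f = f' := LFHom.ext_toFunV (funext fun v =>
    T.isAddressing_addr.injective (congrFun (List.ofFn_injective h₂) v))
  rfl

noncomputable instance {T : LForest Q} : LinearOrder (Index T₀ T) :=
  LinearOrder.lift' Index.key Index.key_injective

/-- The labels used to encode indices: those of the added root, and those of the vertices. -/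
abbrev CodeLabel (T₀ : Fin k → LForest Q) : Type :=
  Fin k ⊕ (Q × Set (Σ j : Fin k, Fin (T₀ j).n))

/-- The quasi-order on the labels used to encode indices. -/
def codeRel (T₀ : Fin k → LForest Q) : CodeLabel T₀ → CodeLabel T₀ → Prop :=
  Sum.LiftRel (· = ·) fun a b => a.1 ≤ b.1 ∧ a.2 = b.2

instance : IsPreorder (CodeLabel T₀) (codeRel T₀) where
  refl := by
    rintro (j | a)
    · exact .inl rfl
    · exact .inr ⟨le_rfl, rfl⟩
  trans := by
    rintro _ _ _ (⟨h₁⟩ | ⟨h₁⟩) (⟨h₂⟩ | ⟨h₂⟩)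
    · exact .inl (h₁.trans h₂)
    · exact .inr ⟨h₁.1.trans h₂.1, h₁.2.trans h₂.2⟩

theorem wellQuasiOrdered_codeRel (hQ : WellQuasiOrdered fun a b : Q => a ≤ b) :
    WellQuasiOrdered (codeRel T₀) :=
  (Finite.wellQuasiOrdered _).sum (hQ.prod (Finite.wellQuasiOrdered _))

/-- The label of a vertex in the encoding of an index. -/
def Index.codeLabel {T : LForest Q} (s : Index T₀ T) (v : Fin T.n) : CodeLabel T₀ :=
  .inr (T.label v, {p | ∃ i, p = ⟨s.1, i⟩ ∧ s.2.toFunV i = v})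

/-- The encoding of an index by a labeled plane tree. -/
noncomputable def Index.code {T : LForest Q} (s : Index T₀ T) : List ℕ → Option (CodeLabel T₀) :=
  SimpleGraph.IsAddressing.code (.inl s.1) T.addr s.codeLabel

theorem Index.exists_of_emb {T T' : LForest Q} {s : Index T₀ T} {s' : Index T₀ T'}
    (h : PlaneTree.Emb (codeRel T₀) s.code s'.code) :
    ∃ (φ : List ℕ → List ℕ) (σ : LFHom T T'), PlaneTree.IsPlaneEmb φ ∧
      (∀ v, T'.addr (σ.toFunV v) = φ (T.addr v)) ∧
      ∃ f : LFHom (T₀ s.1) T', f.toFunV = σ.toFunV ∘ s.2.toFunV ∧ s' = ⟨s.1, f⟩ := by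
  obtain ⟨φ, hφ, h⟩ := h
  obtain ⟨j, f⟩ := s
  obtain ⟨j', f'⟩ := s'
  obtain ⟨b, hb, hjb⟩ := h [] (.inl j) (by simp [Index.code, SimpleGraph.IsAddressing.code])
  obtain rfl : j = j' := by
    obtain ⟨-, rfl⟩ | ⟨v, -, rfl⟩ := SimpleGraph.IsAddressing.eq_of_code_eq_some hb
    · exact Sum.liftRel_inl_inl.1 hjb
    · exact absurd hjb Sum.not_liftRel_inl_inr
  have key : ∀ v, ∃ v', T'.addr v' = φ (T.addr v) ∧ T.label v ≤ T'.label v' ∧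
      ∀ i, f.toFunV i = v → f'.toFunV i = v' := by
    intro v
    obtain ⟨b, hb, hvb⟩ := h _ _ (T.isAddressing_addr.code_apply v)
    obtain ⟨-, rfl⟩ | ⟨v', hv', rfl⟩ := SimpleGraph.IsAddressing.eq_of_code_eq_some hb
    · exact absurd hvb Sum.not_liftRel_inr_inl
    · obtain ⟨hle, heq⟩ := Sum.liftRel_inr_inr.1 hvb
      refine ⟨v', hv', hle, fun i hi => ?_⟩
      obtain ⟨i', hi', hv⟩ := heq.subset ⟨i, rfl, hi⟩
      obtain rfl : i = i' := eq_of_heq (Sigma.mk.inj hi').2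
      exact hv
  choose σV hσ hle hf using key
  obtain ⟨τ, rfl⟩ := TMHom.exists_of_isPlaneEmb T.isAddressing_addr T'.isAddressing_addr hφ hσ
  exact ⟨φ, ⟨τ, hle⟩, hφ, hσ, f', funext fun i => hf _ i rfl, rfl⟩

theorem Index.divides {A : Type} [CommRing A] (𝓜 : LFMod Q A) (x : ∀ j, 𝓜.M (T₀ j))
    {s s' : Σ T, Index T₀ T} (h : PlaneTree.Emb (codeRel T₀) s.2.code s'.2.code) :
    GroebnerModule.Divides (fun T T' => Set.range fun f : LFHom T T' => 𝓜.act f)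
      (fun T (i : Index T₀ T) => 𝓜.act i.2 (x i.1)) s s' := by
  obtain ⟨T, s⟩ := s
  obtain ⟨T', s'⟩ := s'
  obtain ⟨φ, σ, hφ, hσ, f, hf, hs'⟩ := Index.exists_of_emb h
  dsimp only at σ hσ f hf hs'
  subst hs'
  choose c hc hact using fun i : Index T₀ T => i.2.exists_comp σ
  refine ⟨_, ⟨σ, rfl⟩, fun i => ⟨i.1, c i⟩, fun i i' hii => ?_, fun i => ?_, ?_⟩
  · have hkey : ∀ i : Index T₀ T, Index.key (⟨i.1, c i⟩ : Index T₀ T') =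
        [(i.1 : ℕ)] :: (List.ofFn fun v => T.addr (i.2.toFunV v)).map φ := by
      intro i
      simp only [Index.key, List.map_ofFn, hc]
      congr 2
      exact funext fun v => hσ _
    change Index.key _ < Index.key _
    rw [hkey, hkey, List.cons_lt_cons_iff]
    exact (List.cons_lt_cons_iff.1 (show i.key < i'.key from hii)).imp_right fun h =>
      ⟨h.1, List.map_lt_map_of_strictMono hφ.strictMono h.2⟩
  · dsimp only
    rw [hact]
    rfl
  · exact congrArg (Sigma.mk s.1) (LFHom.ext_toFunV ((hc s).trans hf.symm))

end LForest

/-- for a well-quasi-ordered `Q` and a Noetherian commutative ring `A`, the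
category of finite simple forests with vertices labeled by `Q`, with morphisms the
label-compatible topological minor morphisms, is Noetherian over `A`: every submodule `N`
of a finitely generated module `𝓜` (a family of `A`-submodules `N T ⊆ 𝓜.M T` preserved
by all induced maps) is finitely generated. -/
theorem labeledForests_noetherian (Q : Type) [Preorder Q]
    (hwqo : ∀ f : ℕ → Q, ∃ i j : ℕ, i < j ∧ f i ≤ f j)
    (A : Type) [CommRing A] [IsNoetherianRing A]
    (𝓜 : LFMod Q A) (hM : 𝓜.IsFG)
    (N : ∀ T : LForest Q, Submodule A (𝓜.M T))
    (hN : ∀ ⦃T T' : LForest Q⦄ (f : LFHom T T'), ∀ x ∈ N T, 𝓜.act f x ∈ N T') :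
    ∃ (k : ℕ) (T : Fin k → LForest Q) (x : ∀ j : Fin k, 𝓜.M (T j)),
      (∀ j : Fin k, x j ∈ N (T j)) ∧
      ∀ (T' : LForest Q), ∀ y ∈ N T',
        y ∈ Submodule.span A
          {z : 𝓜.M T' | ∃ (j : Fin k) (f : LFHom (T j) T'), z = 𝓜.act f (x j)} := by
  classical
  obtain ⟨k, T₀, x, hx⟩ := hM
  have hspan : ∀ T, Submodule.span A
      (Set.range fun i : LForest.Index T₀ T => 𝓜.act i.2 (x i.1)) = ⊤ := by
    refine fun T => Submodule.eq_top_iff'.2 fun y => Submodule.span_mono ?_ (hx T y)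
    rintro _ ⟨j, f, rfl⟩
    exact ⟨⟨j, f⟩, rfl⟩
  have hnoeth : ∀ T, IsNoetherian A (𝓜.M T) := fun T =>
    have : Module.Finite A (𝓜.M T) := ⟨hspan T ▸ Submodule.fg_span (Set.finite_range _)⟩
    inferInstance
  obtain ⟨F, hF⟩ := GroebnerModule.exists_finset_generating
    (fun T T' => Set.range fun f : LFHom T T' => 𝓜.act f)
    (fun T (i : LForest.Index T₀ T) => 𝓜.act i.2 (x i.1)) hspan N
    (by
      rintro T T' _ ⟨f, rfl⟩
      exact hN f)
    (fun s => by
      have := PlaneTree.Emb.isPreorder (LForest.codeRel T₀)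
      obtain ⟨e, he⟩ := (PlaneTree.kruskal
        (LForest.wellQuasiOrdered_codeRel (T₀ := T₀) hwqo)).exists_monotone_subseq
        (f := fun n => (s n).2.code) fun n => (s n).1.isAddressing_addr.code_mem_finiteTrees
      exact ⟨e, fun i j hij => LForest.Index.divides 𝓜 x (he i j hij.le)⟩)
  choose gen hgen using fun T => (hnoeth T).noetherian (N T)
  have e := (F.sigma gen).equivFin.symm
  refine ⟨_, fun i => (e i).1.1, fun i => (e i).1.2, fun i => ?_, fun T' y hy => ?_⟩
  · rw [← hgen]
    exact Submodule.subset_span (Finset.mem_sigma.1 (e i).2).2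
  · refine Submodule.span_le.2 ?_ (hF T' y hy)
    rintro _ ⟨T, hT, z, hz, _, ⟨f, rfl⟩, rfl⟩
    rw [← hgen] at hz
    have := Submodule.apply_mem_span_image_of_mem_span (𝓜.act f) hz
    refine Submodule.span_mono ?_ this
    rintro _ ⟨w, hw, rfl⟩
    obtain ⟨i, hi⟩ := e.surjective ⟨⟨T, w⟩, Finset.mem_sigma.2 ⟨hT, hw⟩⟩
    have h1 : (e i).1 = ⟨T, w⟩ := congrArg Subtype.val hi
    refine ⟨i, ?_⟩
    change ∃ g : LFHom (e i).1.1 T', _ = 𝓜.act g (e i).1.2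
    rw [h1]
    exact ⟨f, rfl⟩
end

section
/- For all positive integers j ≠ k, there is no topological minor morphism from R_j' to R_k'. Consequently, the collection {R_k'}_{k ≥ 1} is an antichain for the topological minor relation. -/
/-- The `k`-th Robertson chain `R_k`: vertices `v_0, …, v_k` (the `Sum.inl`s) and
`w_1, …, w_k` (the `Sum.inr`s, with `w_{m+1}` encoded as `Sum.inr m`), where `v_m` is
adjacent to `v_{m+1}`, and `w_{m+1}` is adjacent to both `v_m` and `v_{m+1}`:
each edge of a path with `k+1` vertices is doubled and the double is subdivided once. -/
def robertsonChain (k : ℕ) : SimpleGraph (Fin (k + 1) ⊕ Fin k) :=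
  SimpleGraph.fromRel (fun x y =>
    match x, y with
    | Sum.inl a, Sum.inl b => (b : ℕ) = (a : ℕ) + 1
    | Sum.inl a, Sum.inr j => (a : ℕ) = (j : ℕ) ∨ (a : ℕ) = (j : ℕ) + 1
    | _, _ => False)

/-- The graph `R_k'` obtained from the Robertson chain `R_k` by attaching three leaves at
`v_0` (the first `Fin 3` summand) and three leaves at `v_k` (the second `Fin 3` summand). -/
def robertsonChainLeaves (k : ℕ) :
    SimpleGraph ((Fin (k + 1) ⊕ Fin k) ⊕ (Fin 3 ⊕ Fin 3)) :=
  SimpleGraph.fromRel (fun x y =>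
    match x, y with
    | Sum.inl (Sum.inl a), Sum.inl (Sum.inl b) => (b : ℕ) = (a : ℕ) + 1
    | Sum.inl (Sum.inl a), Sum.inl (Sum.inr j) => (a : ℕ) = (j : ℕ) ∨ (a : ℕ) = (j : ℕ) + 1
    | Sum.inl (Sum.inl a), Sum.inr (Sum.inl _) => (a : ℕ) = 0
    | Sum.inl (Sum.inl a), Sum.inr (Sum.inr _) => (a : ℕ) = k
    | _, _ => False)

theorem PathQ.exists_walk_s15 {V : Type} {G : SimpleGraph V} (q : PathQ G) {x y : V}
    (h : q.ends = s(x, y)) : ∃ w : G.Walk x y, ∀ z, z ∈ w.support ↔ z ∈ q.suppSet := by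
  induction q using Quotient.inductionOn with
  | h p =>
    obtain ⟨a, b, w, hw⟩ := p
    have h' : s(a, b) = s(x, y) := h
    rcases Sym2.eq_iff.1 h' with ⟨rfl, rfl⟩ | ⟨rfl, rfl⟩
    · exact ⟨w, fun z => Iff.rfl⟩
    · exact ⟨w.reverse, fun z => by rw [SimpleGraph.Walk.support_reverse, List.mem_reverse]; rfl⟩

namespace TMHom

variable {V V' : Type} {G : SimpleGraph V} {G' : SimpleGraph V'}

theorem exists_walk_s15 (ρ : TMHom G G') {u v : V} (h : G.Adj u v) :
    ∃ w : G'.Walk (ρ.toFunV u) (ρ.toFunV v),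
      ∀ z, z ∈ w.support ↔ z ∈ (ρ.toFunE ⟨s(u, v), h⟩).suppSet :=
  PathQ.exists_walk_s15 _ (ρ.ends_eq ⟨s(u, v), h⟩)

theorem degree_le (ρ : TMHom G G') (v : V) [Fintype (G.neighborSet v)]
    [Fintype (G'.neighborSet (ρ.toFunV v))] : G.degree v ≤ G'.degree (ρ.toFunV v) := by
  have hex (u : G.neighborSet v) : ∃ x : G'.neighborSet (ρ.toFunV v),
      (x : V') ∈ (ρ.toFunE ⟨s(v, u), u.2⟩).suppSet := by
    obtain ⟨w, hw⟩ := ρ.exists_walk_s15 u.2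
    have hnil : ¬ w.Nil := SimpleGraph.Walk.not_nil_of_ne fun h => G.ne_of_adj u.2 (ρ.injV h)
    exact ⟨⟨w.snd, w.adj_snd hnil⟩, (hw _).1 (w.getVert_mem_support 1)⟩
  choose g hg using hex
  rw [← G.card_neighborSet_eq_degree, ← G'.card_neighborSet_eq_degree]
  refine Fintype.card_le_of_injective g fun u u' huu' => ?_
  by_contra hne
  have hedge : (⟨s(v, u), u.2⟩ : G.edgeSet) ≠ ⟨s(v, u'), u'.2⟩ := fun h =>
    hne (Subtype.ext (Sym2.congr_right.1 (congrArg Subtype.val h)))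
  have hmem : (g u : V') ∈ ({ρ.toFunV v} : Set V') := by
    rw [← ρ.inter_shared _ _ hedge v (Sym2.mem_mk_left _ _) (Sym2.mem_mk_left _ _)]
    exact ⟨hg u, huu' ▸ hg u'⟩
  exact G'.ne_of_adj (g u).2 hmem.symm

end TMHom

namespace robertsonChainLeaves

/-- The vertex `v_i` of the leafed chain. -/
abbrev spine {k : ℕ} (i : Fin (k + 1)) : (Fin (k + 1) ⊕ Fin k) ⊕ (Fin 3 ⊕ Fin 3) :=
  Sum.inl (Sum.inl i)

/-- The vertex `w_{m+1}` of the leafed chain. -/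
abbrev sub {k : ℕ} (m : Fin k) : (Fin (k + 1) ⊕ Fin k) ⊕ (Fin 3 ⊕ Fin 3) :=
  Sum.inl (Sum.inr m)

/-- A linear layout of the leafed chain in which each `v_i` separates the vertices on its two sides. -/
def pos (k : ℕ) : (Fin (k + 1) ⊕ Fin k) ⊕ (Fin 3 ⊕ Fin 3) → ℕ
  | Sum.inl (Sum.inl i) => 2 * i + 1
  | Sum.inl (Sum.inr m) => 2 * m + 2
  | Sum.inr (Sum.inl _) => 0
  | Sum.inr (Sum.inr _) => 2 * k + 2

variable {k : ℕ}

theorem pos_le_of_adj {x y : (Fin (k + 1) ⊕ Fin k) ⊕ (Fin 3 ⊕ Fin 3)}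
    (h : (robertsonChainLeaves k).Adj x y) {c : Fin (k + 1)} (hx : pos k x < pos k (spine c)) :
    pos k y ≤ pos k (spine c) := by
  have hc := c.2
  rcases x with (a | a) | (a | a) <;> rcases y with (b | b) | (b | b) <;>
    simp [robertsonChainLeaves, pos, -Fin.val_eq_zero_iff] at h hx ⊢ <;> omega

theorem eq_spine_of_pos_eq {x : (Fin (k + 1) ⊕ Fin k) ⊕ (Fin 3 ⊕ Fin 3)} {c : Fin (k + 1)}
    (h : pos k x = pos k (spine c)) : x = spine c := by
  rcases x with (a | a) | (a | a) <;>
    simp [pos, Fin.ext_iff, -Fin.val_eq_zero_iff] at h ⊢ <;> omega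

theorem spine_mem_support {x y : (Fin (k + 1) ⊕ Fin k) ⊕ (Fin 3 ⊕ Fin 3)}
    (w : (robertsonChainLeaves k).Walk x y) {c : Fin (k + 1)}
    (hx : pos k x < pos k (spine c)) (hy : pos k (spine c) < pos k y) :
    spine c ∈ w.support := by
  induction w with
  | nil => omega
  | @cons x z y h w ih =>
    rw [SimpleGraph.Walk.support_cons]
    refine List.mem_cons_of_mem _ ?_
    rcases (pos_le_of_adj h hx).lt_or_eq with hlt | heq
    · exact ih hlt hy
    · rw [← eq_spine_of_pos_eq heq]
      exact w.start_mem_support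

theorem spine_mem_support_of_between {a b c : Fin (k + 1)}
    (w : (robertsonChainLeaves k).Walk (spine a) (spine b))
    (h : a < c ∧ c < b ∨ b < c ∧ c < a) : spine c ∈ w.support := by
  simp only [Fin.lt_def] at h
  rcases h with h | h
  · exact spine_mem_support w (by simp only [pos]; omega) (by simp only [pos]; omega)
  · have := spine_mem_support (c := c) w.reverse (by simp only [pos]; omega)
      (by simp only [pos]; omega)
    simpa using this

theorem adj_spine {i : ℕ} (hi : i < k) :
    (robertsonChainLeaves k).Adj (spine ⟨i, by omega⟩) (spine ⟨i + 1, by omega⟩) := by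
  simp [robertsonChainLeaves]

theorem adj_spine_sub {i : ℕ} (hi : i < k) :
    (robertsonChainLeaves k).Adj (spine ⟨i, by omega⟩) (sub ⟨i, hi⟩) := by
  simp [robertsonChainLeaves]

theorem adj_sub_spine {i : ℕ} (hi : i < k) :
    (robertsonChainLeaves k).Adj (sub ⟨i, hi⟩) (spine ⟨i + 1, by omega⟩) := by
  simp [robertsonChainLeaves]

theorem adj_left (t : Fin 3) :
    (robertsonChainLeaves k).Adj (spine 0) (Sum.inr (Sum.inl t)) := by
  simp [robertsonChainLeaves]

theorem adj_right (t : Fin 3) :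
    (robertsonChainLeaves k).Adj (spine (Fin.last k)) (Sum.inr (Sum.inr t)) := by
  simp [robertsonChainLeaves]

theorem adj_sub_iff {m : Fin k} {x : (Fin (k + 1) ⊕ Fin k) ⊕ (Fin 3 ⊕ Fin 3)} :
    (robertsonChainLeaves k).Adj (sub m) x ↔ x = spine m.castSucc ∨ x = spine m.succ := by
  rcases x with (a | a) | (a | a) <;>
    simp [robertsonChainLeaves, Fin.ext_iff, -Fin.val_eq_zero_iff]

theorem eq_of_adj_left {t : Fin 3} {x : (Fin (k + 1) ⊕ Fin k) ⊕ (Fin 3 ⊕ Fin 3)}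
    (h : (robertsonChainLeaves k).Adj (Sum.inr (Sum.inl t)) x) : x = spine 0 := by
  rcases x with (a | a) | (a | a) <;>
    simp [robertsonChainLeaves, Fin.ext_iff, -Fin.val_eq_zero_iff] at h ⊢
  exact h

theorem eq_of_adj_right {t : Fin 3} {x : (Fin (k + 1) ⊕ Fin k) ⊕ (Fin 3 ⊕ Fin 3)}
    (h : (robertsonChainLeaves k).Adj (Sum.inr (Sum.inr t)) x) : x = spine (Fin.last k) := by
  rcases x with (a | a) | (a | a) <;>
    simp [robertsonChainLeaves, Fin.ext_iff, -Fin.val_eq_zero_iff] at h ⊢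
  exact h

section Degree

open scoped Classical

theorem three_le_degree_spine (i : Fin (k + 1)) :
    3 ≤ (robertsonChainLeaves k).degree (spine i) := by
  rw [← SimpleGraph.card_neighborFinset_eq_degree]
  by_cases h₀ : i = 0
  · subst h₀
    refine le_trans (by simp) (Finset.card_le_card
      (s := Finset.univ.map ⟨fun t : Fin 3 => Sum.inr (Sum.inl t), fun _ _ h => by simpa using h⟩)
      fun x hx => ?_)
    simp only [Finset.mem_map, Finset.mem_univ, true_and] at hx
    obtain ⟨t, rfl⟩ := hx
    exact (SimpleGraph.mem_neighborFinset _ _ _).2 (adj_left t)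
  by_cases hk : i = Fin.last k
  · subst hk
    refine le_trans (by simp) (Finset.card_le_card
      (s := Finset.univ.map ⟨fun t : Fin 3 => Sum.inr (Sum.inr t), fun _ _ h => by simpa using h⟩)
      fun x hx => ?_)
    simp only [Finset.mem_map, Finset.mem_univ, true_and] at hx
    obtain ⟨t, rfl⟩ := hx
    exact (SimpleGraph.mem_neighborFinset _ _ _).2 (adj_right t)
  obtain ⟨i, hi⟩ := i
  obtain ⟨i, rfl⟩ : ∃ n, i = n + 1 :=
    Nat.exists_eq_succ_of_ne_zero (by simpa [Fin.ext_iff] using h₀)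
  have hik : i + 1 < k := by
    simp [Fin.ext_iff] at hk
    omega
  refine le_trans (b := Finset.card {spine ⟨i, by omega⟩, spine ⟨i + 1 + 1, by omega⟩,
    sub ⟨i, by omega⟩}) ?_ (Finset.card_le_card fun x hx => ?_)
  · rw [Finset.card_eq_three.2 ⟨_, _, _, by simp; omega, by simp, by simp, rfl⟩]
  · rw [SimpleGraph.mem_neighborFinset]
    simp only [Finset.mem_insert, Finset.mem_singleton] at hx
    rcases hx with rfl | rfl | rfl
    · exact (adj_spine (by omega)).symm
    · exact adj_spine hik
    · exact (adj_sub_spine (by omega)).symm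

theorem exists_eq_spine_of_degree {x : (Fin (k + 1) ⊕ Fin k) ⊕ (Fin 3 ⊕ Fin 3)}
    (h : 3 ≤ (robertsonChainLeaves k).degree x) : ∃ i, x = spine i := by
  rw [← SimpleGraph.card_neighborFinset_eq_degree] at h
  rcases x with (a | m) | (t | t)
  · exact ⟨a, rfl⟩
  · have hsub : (robertsonChainLeaves k).neighborFinset (sub m) ⊆
        {spine m.castSucc, spine m.succ} := fun x hx => by
      simpa using adj_sub_iff.1 ((SimpleGraph.mem_neighborFinset _ _ _).1 hx)
    have := (h.trans (Finset.card_le_card hsub)).trans Finset.card_le_two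
    omega
  · have hsub : (robertsonChainLeaves k).neighborFinset (Sum.inr (Sum.inl t)) ⊆ {spine 0} :=
      fun x hx => by
        simpa using eq_of_adj_left ((SimpleGraph.mem_neighborFinset _ _ _).1 hx)
    have := h.trans (Finset.card_le_card hsub)
    simp at this
  · have hsub : (robertsonChainLeaves k).neighborFinset (Sum.inr (Sum.inr t)) ⊆
        {spine (Fin.last k)} := fun x hx => by
      simpa using eq_of_adj_right ((SimpleGraph.mem_neighborFinset _ _ _).1 hx)
    have := h.trans (Finset.card_le_card hsub)
    simp at this

theorem five_le_degree_spine (hk : 0 < k) {i : Fin (k + 1)} (hi : i = 0 ∨ i = Fin.last k) :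
    5 ≤ (robertsonChainLeaves k).degree (spine i) := by
  rw [← SimpleGraph.card_neighborFinset_eq_degree]
  obtain ⟨n, rfl⟩ : ∃ n, k = n + 1 := Nat.exists_eq_succ_of_ne_zero hk.ne'
  rcases hi with rfl | rfl
  · refine le_trans (b := Finset.card {spine ⟨0 + 1, by omega⟩, sub ⟨0, hk⟩,
      Sum.inr (Sum.inl 0), Sum.inr (Sum.inl 1), Sum.inr (Sum.inl 2)}) ?_
      (Finset.card_le_card fun x hx => ?_)
    · simp
    · rw [SimpleGraph.mem_neighborFinset]
      simp only [Finset.mem_insert, Finset.mem_singleton] at hx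
      rcases hx with rfl | rfl | rfl | rfl | rfl
      · exact adj_spine hk
      · exact adj_spine_sub hk
      all_goals exact adj_left _
  · refine le_trans (b := Finset.card {spine ⟨n, by omega⟩, sub ⟨n, by omega⟩,
      Sum.inr (Sum.inr 0), Sum.inr (Sum.inr 1), Sum.inr (Sum.inr 2)}) ?_
      (Finset.card_le_card fun x hx => ?_)
    · simp
    · rw [SimpleGraph.mem_neighborFinset]
      simp only [Finset.mem_insert, Finset.mem_singleton] at hx
      rcases hx with rfl | rfl | rfl | rfl | rfl
      · exact (adj_spine (Nat.lt_succ_self n)).symm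
      · exact (adj_sub_spine (Nat.lt_succ_self n)).symm
      all_goals exact adj_right _

theorem eq_zero_or_last_of_degree {i : Fin (k + 1)}
    (h : 5 ≤ (robertsonChainLeaves k).degree (spine i)) : (i : ℕ) = 0 ∨ (i : ℕ) = k := by
  by_contra! hi
  have hik := i.2
  rw [← SimpleGraph.card_neighborFinset_eq_degree] at h
  have hsub : (robertsonChainLeaves k).neighborFinset (spine i) ⊆
      {spine ⟨i - 1, by omega⟩, spine ⟨i + 1, by omega⟩,
        sub ⟨i - 1, by omega⟩, sub ⟨i, by omega⟩} := fun x hx => by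
    rw [SimpleGraph.mem_neighborFinset] at hx
    rcases x with (a | a) | (a | a) <;>
      simp [robertsonChainLeaves, Fin.ext_iff, -Fin.val_eq_zero_iff] at hx ⊢ <;> omega
  have := (h.trans (Finset.card_le_card hsub)).trans Finset.card_le_four
  omega

end Degree

end robertsonChainLeaves

namespace TMHom

open robertsonChainLeaves

variable {j k : ℕ} (ρ : TMHom (robertsonChainLeaves j) (robertsonChainLeaves k))

theorem exists_spine_index (i : Fin (j + 1)) : ∃ a, ρ.toFunV (spine i) = spine a := by
  classical
  exact exists_eq_spine_of_degree ((three_le_degree_spine i).trans (ρ.degree_le _))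

theorem spine_index_end (hj : 0 < j) {i : Fin (j + 1)} (hi : i = 0 ∨ i = Fin.last j)
    {a : Fin (k + 1)} (ha : ρ.toFunV (spine i) = spine a) : (a : ℕ) = 0 ∨ (a : ℕ) = k := by
  classical
  apply eq_zero_or_last_of_degree
  rw [← ha]
  exact (five_le_degree_spine hj hi).trans (ρ.degree_le _)

theorem not_between (i : ℕ) (hi : i < j) {a b c : Fin (k + 1)}
    (ha : ρ.toFunV (spine ⟨i, by omega⟩) = spine a)
    (hb : ρ.toFunV (spine ⟨i + 1, by omega⟩) = spine b) :
    ¬ (a < c ∧ c < b ∨ b < c ∧ c < a) := by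
  intro h
  have hca : (spine c : (Fin (k + 1) ⊕ Fin k) ⊕ (Fin 3 ⊕ Fin 3)) ≠ spine a := fun e => by
    simp only [Sum.inl.injEq] at e
    subst e
    simp at h
  have hcb : (spine c : (Fin (k + 1) ⊕ Fin k) ⊕ (Fin 3 ⊕ Fin 3)) ≠ spine b := fun e => by
    simp only [Sum.inl.injEq] at e
    subst e
    simp at h
  obtain ⟨w, hw⟩ := ρ.exists_walk_s15 (adj_spine hi)
  obtain ⟨w₁, hw₁⟩ := ρ.exists_walk_s15 (adj_spine_sub hi)
  obtain ⟨w₂, hw₂⟩ := ρ.exists_walk_s15 (adj_sub_spine hi)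
  have hmem := spine_mem_support_of_between (w.copy ha hb) h
  have hmem' := spine_mem_support_of_between ((w₁.append w₂).copy ha hb) h
  rw [SimpleGraph.Walk.support_copy, hw] at hmem
  rw [SimpleGraph.Walk.support_copy, SimpleGraph.Walk.mem_support_append_iff, hw₁, hw₂] at hmem'
  rcases hmem' with hmem' | hmem'
  · have := ρ.inter_shared ⟨s(_, _), adj_spine hi⟩ ⟨s(_, _), adj_spine_sub hi⟩
      (fun e => by simpa using congrArg Subtype.val e)
      (spine ⟨i, by omega⟩) (by simp) (by simp)
    exact hca (ha ▸ (this ▸ ⟨hmem, hmem'⟩ : spine c ∈ ({ρ.toFunV _} : Set _)))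
  · have := ρ.inter_shared ⟨s(_, _), adj_spine hi⟩ ⟨s(_, _), adj_sub_spine hi⟩
      (fun e => by simpa using congrArg Subtype.val e)
      (spine ⟨i + 1, by omega⟩) (by simp) (by simp)
    exact hcb (hb ▸ (this ▸ ⟨hmem, hmem'⟩ : spine c ∈ ({ρ.toFunV _} : Set _)))

theorem spine_index_step (i : ℕ) (hi : i < j) {a b : Fin (k + 1)}
    (ha : ρ.toFunV (spine ⟨i, by omega⟩) = spine a)
    (hb : ρ.toFunV (spine ⟨i + 1, by omega⟩) = spine b) :
    (b : ℕ) ≤ a + 1 ∧ (a : ℕ) ≤ b + 1 := by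
  by_contra! h
  have ha' := a.2
  have hb' := b.2
  by_cases hab : (b : ℕ) ≤ a + 1
  · refine ρ.not_between i hi (c := ⟨b + 1, ?_⟩) ha hb (Or.inr ?_)
    · omega
    · simp only [Fin.lt_def]; omega
  · refine ρ.not_between i hi (c := ⟨a + 1, ?_⟩) ha hb (Or.inl ?_)
    · omega
    · simp only [Fin.lt_def]; omega

end TMHom

/-- for distinct positive `j ≠ k` there is no topological minor morphism
`R_j' → R_k'`; consequently `{R_k'}_{k ≥ 1}` is an antichain for the topological minor
relation. -/
theorem robertsonChainLeaves_antichain (j k : ℕ) (hj : 0 < j) (hk : 0 < k) (hjk : j ≠ k) :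
    IsEmpty (TMHom (robertsonChainLeaves j) (robertsonChainLeaves k)) := by
  refine ⟨fun ρ => hjk (le_antisymm ?_ ?_)⟩
  · choose f hf using ρ.exists_spine_index
    have hinj : Function.Injective f := fun a b hab => by
      have h := ρ.injV ((hf a).trans ((congrArg _ hab).trans (hf b).symm))
      simpa using h
    simpa using Fintype.card_le_of_injective f hinj
  · choose f hf using ρ.exists_spine_index
    have hstep (i : ℕ) (hi : i < j) :
        (f ⟨i + 1, by omega⟩ : ℕ) ≤ f ⟨i, by omega⟩ + 1 ∧
          (f ⟨i, by omega⟩ : ℕ) ≤ f ⟨i + 1, by omega⟩ + 1 :=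
      ρ.spine_index_step i hi (hf _) (hf _)
    have hdist (i : ℕ) (hi : i ≤ j) :
        (f ⟨i, by omega⟩ : ℕ) ≤ f 0 + i ∧ (f 0 : ℕ) ≤ f ⟨i, by omega⟩ + i := by
      induction i with
      | zero => exact ⟨le_rfl, le_rfl⟩
      | succ i ih =>
        have h₁ := ih (by omega)
        have h₂ := hstep i (by omega)
        omega
    have h₀ := ρ.spine_index_end hj (Or.inl rfl) (hf 0)
    have h₁ := ρ.spine_index_end hj (Or.inr rfl) (hf (Fin.last j))
    have hne : (f 0 : ℕ) ≠ f (Fin.last j) := fun h => by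
      have h := ρ.injV ((hf 0).trans ((congrArg _ (Fin.ext h)).trans (hf _).symm))
      simp [Fin.ext_iff] at h
      omega
    have h₂ : (f (Fin.last j) : ℕ) ≤ f 0 + j ∧ (f 0 : ℕ) ≤ f (Fin.last j) + j := hdist j le_rfl
    omega
end
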